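/- arXiv:1006.1759 — 2 statements merged into one kernel-verified Lean document; each statement's English description precedes it below -/
import Mathlib

section
/- Let K be a field, n ≥ 2 an integer, and r, s ≥ 1 integers with gcd(r, n−1) = gcd(s, n−1). Then there exists a K-algebra isomorphism φ: M_r(L_n) → M_s(L_n) with the property that whenever every entry of a matrix A ∈ M_r(L_n) is a finite (possibly empty) sum of monomials of the form y_I x_J with I, J words over {1,…,n}, then every entry of φ(A) is also such a finite sum. -/
open scoped BigOperators

/-- Defining relations of the Leavitt algebra `L_K(1,n)`. -/
inductive LeavittRel (K : Type) [Field K] (n : ℕ) :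
    FreeAlgebra K (Fin n ⊕ Fin n) → FreeAlgebra K (Fin n ⊕ Fin n) → Prop
  | xy (i j : Fin n) :
      LeavittRel K n (FreeAlgebra.ι K (Sum.inl i) * FreeAlgebra.ι K (Sum.inr j))
        (if i = j then 1 else 0)
  | yx :
      LeavittRel K n (∑ j : Fin n, FreeAlgebra.ι K (Sum.inr j) * FreeAlgebra.ι K (Sum.inl j)) 1

/-- The Leavitt algebra `L_n = L_K(1,n)`. -/
abbrev Leavitt (K : Type) [Field K] (n : ℕ) := RingQuot (LeavittRel K n)

/-- The generator `x_i` of the Leavitt algebra. -/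
noncomputable def lx (K : Type) [Field K] (n : ℕ) (i : Fin n) : Leavitt K n :=
  RingQuot.mkAlgHom K (LeavittRel K n) (FreeAlgebra.ι K (Sum.inl i))

/-- The generator `y_i` of the Leavitt algebra. -/
noncomputable def ly (K : Type) [Field K] (n : ℕ) (i : Fin n) : Leavitt K n :=
  RingQuot.mkAlgHom K (LeavittRel K n) (FreeAlgebra.ι K (Sum.inr i))

/-- `x_I = x_{i_k} ⋯ x_{i_1}` for a word `I = (i_1, …, i_k)`. -/
noncomputable def xW (K : Type) [Field K] (n : ℕ) (I : List (Fin n)) : Leavitt K n :=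
  (I.reverse.map (lx K n)).prod

/-- `y_I = y_{i_1} ⋯ y_{i_k}` for a word `I = (i_1, …, i_k)`. -/
noncomputable def yW (K : Type) [Field K] (n : ℕ) (I : List (Fin n)) : Leavitt K n :=
  (I.map (ly K n)).prod

/-- Auxiliary anti-homomorphism used to construct the involution on `L_n`. -/
noncomputable def leavittStarAux (K : Type) [Field K] (n : ℕ) :
    FreeAlgebra K (Fin n ⊕ Fin n) →ₐ[K] (Leavitt K n)ᵐᵒᵖ :=
  FreeAlgebra.lift K fun s =>
    MulOpposite.op (RingQuot.mkAlgHom K (LeavittRel K n) (FreeAlgebra.ι K s.swap))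

theorem leavittStarAux_rel (K : Type) [Field K] (n : ℕ) :
    ∀ ⦃a b : FreeAlgebra K (Fin n ⊕ Fin n)⦄, LeavittRel K n a b →
      leavittStarAux K n a = leavittStarAux K n b := by
  intro a b h
  induction h with
  | xy i j =>
    have h1 : (RingQuot.mkAlgHom K (LeavittRel K n))
        (FreeAlgebra.ι K (Sum.inl j) * FreeAlgebra.ι K (Sum.inr i)) =
        (RingQuot.mkAlgHom K (LeavittRel K n)) (if j = i then 1 else 0) :=
      RingQuot.mkAlgHom_rel K (LeavittRel.xy j i)
    simp only [leavittStarAux, map_mul, FreeAlgebra.lift_ι_apply, Sum.swap_inl, Sum.swap_inr]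
    rw [← MulOpposite.op_mul, ← map_mul, h1]
    by_cases hij : i = j
    · subst hij; simp
    · simp [hij, Ne.symm hij]
  | yx =>
    have h1 : (RingQuot.mkAlgHom K (LeavittRel K n))
        (∑ j : Fin n, FreeAlgebra.ι K (Sum.inr j) * FreeAlgebra.ι K (Sum.inl j)) =
        (RingQuot.mkAlgHom K (LeavittRel K n)) 1 :=
      RingQuot.mkAlgHom_rel K LeavittRel.yx
    simp only [leavittStarAux, map_sum, map_mul, FreeAlgebra.lift_ι_apply, Sum.swap_inl,
      Sum.swap_inr, map_one]
    have key : ∀ x : Fin n,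
        MulOpposite.op ((RingQuot.mkAlgHom K (LeavittRel K n)) (FreeAlgebra.ι K (Sum.inl x))) *
          MulOpposite.op ((RingQuot.mkAlgHom K (LeavittRel K n)) (FreeAlgebra.ι K (Sum.inr x))) =
        MulOpposite.opAddEquiv ((RingQuot.mkAlgHom K (LeavittRel K n))
          (FreeAlgebra.ι K (Sum.inr x) * FreeAlgebra.ι K (Sum.inl x))) := by
      intro x; rw [map_mul]; rfl
    rw [Finset.sum_congr rfl fun x _ => key x, ← map_sum, ← map_sum, h1, map_one]
    rfl

/-- The involution `*` on the Leavitt algebra, as an algebra map into the opposite algebra. -/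
noncomputable def lstarHom (K : Type) [Field K] (n : ℕ) :
    Leavitt K n →ₐ[K] (Leavitt K n)ᵐᵒᵖ :=
  RingQuot.liftAlgHom K ⟨leavittStarAux K n, leavittStarAux_rel K n⟩

/-- The involution `*` on the Leavitt algebra: the unique `K`-linear ring anti-automorphism
with `x_i* = y_i` and `y_i* = x_i`. -/
noncomputable def lstar (K : Type) [Field K] (n : ℕ) (a : Leavitt K n) : Leavitt K n :=
  (lstarHom K n a).unop

/-- An element of `L_n` which is a finite (possibly empty) sum of monomials `y_I x_J`. -/
def IsSumYX (K : Type) [Field K] (n : ℕ) (a : Leavitt K n) : Prop :=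
  ∃ (m : ℕ) (I J : Fin m → List (Fin n)), a = ∑ i, yW K n (I i) * xW K n (J i)

/-- The induced involution on matrices over `L_n`: `(A*)_{ij} = (A_{ji})*`. -/
noncomputable def mstar (K : Type) [Field K] (n r : ℕ)
    (A : Matrix (Fin r) (Fin r) (Leavitt K n)) : Matrix (Fin r) (Fin r) (Leavitt K n) :=
  fun i j => lstar K n (A j i)

/-- The set `P_{n,r}` of unitary matrices over `L_n` all of whose entries are finite sums of
monomials `y_I x_J`. -/
def PsetM (K : Type) [Field K] (n r : ℕ) : Set (Matrix (Fin r) (Fin r) (Leavitt K n)) :=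
  {A | (A * mstar K n r A = 1 ∧ mstar K n r A * A = 1) ∧ ∀ i j, IsSumYX K n (A i j)}

/-- `B` is a complete prefix code: a finite nonempty set of pairwise incomparable words such
that every word is comparable with some element of `B`. -/
def IsCPC (n : ℕ) (B : Set (List (Fin n))) : Prop :=
  B.Finite ∧ B.Nonempty ∧ (∀ u ∈ B, ∀ v ∈ B, u ≠ v → ¬ u <+: v) ∧
    (∀ w : List (Fin n), ∃ u ∈ B, u <+: w ∨ w <+: u)

section Splitting

variable {R C : Type}

/-- The components of a decomposition belong to the family `F`. -/
def SplitMem {ι : Type} (F : C → C → Set R) (p : C) (c : ι → C) (y x : ι → R) : Prop :=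
  ∀ i, y i ∈ F p (c i) ∧ x i ∈ F (c i) p

theorem splitMem_reindex {ι κ : Type} {F : C → C → Set R} {p : C} {c : ι → C} {y x : ι → R}
    (e : κ ≃ ι) : SplitMem F p (c ∘ e) (y ∘ e) (x ∘ e) ↔ SplitMem F p c y x :=
  e.forall_congr_left.trans (by simp [SplitMem])

theorem exists_sigma_equiv [DecidableEq C] {ι : Type} [Fintype ι] (c : ι → C) (f : C → ℕ)
    (hf : ∀ q, Fintype.card {i // c i = q} = f q) :
    ∃ e : (Σ q, Fin (f q)) ≃ ι, c ∘ e = Sigma.fst := by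
  refine ⟨(Equiv.sigmaCongrRight fun q =>
    (Fintype.equivFinOfCardEq (hf q)).symm).trans (Equiv.sigmaFiberEquiv c), ?_⟩
  ext ⟨q, i⟩
  simpa using ((Fintype.equivFinOfCardEq (hf q)).symm i).2

theorem card_sum_fiber [DecidableEq C] {ι κ : Type} [Fintype ι] [Fintype κ] (c : ι → C)
    (d : κ → C) (q : C) :
    Fintype.card {i // Sum.elim c d i = q} =
      Fintype.card {i // c i = q} + Fintype.card {i // d i = q} := by
  rw [← Fintype.card_sum]
  exact Fintype.card_congr Equiv.subtypeSum

theorem card_unit_fiber [DecidableEq C] (p q : C) :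
    Fintype.card {_i : Unit // p = q} = (Pi.single p 1 : C → ℕ) q := by
  by_cases h : p = q
  · subst h; simp
  · simp [h, Ne.symm h]

variable [Ring R]

/-- A decomposition of the idempotent `E p` as an orthogonal sum of copies of the idempotents
`E (c i)`, realised by maps `y i` (from `E (c i)` to `E p`) and `x i` (backwards). -/
structure IsSplit {ι : Type} [Fintype ι] [DecidableEq ι] (E : C → R) (p : C) (c : ι → C)
    (y x : ι → R) : Prop where
  y_mul : ∀ i, y i * E (c i) = y i
  mul_x : ∀ i, E (c i) * x i = x i
  x_mul_y : ∀ i j, x i * y j = if i = j then E (c i) else 0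
  sum_eq : ∑ i, y i * x i = E p

namespace IsSplit

variable {ι κ : Type} [Fintype ι] [DecidableEq ι] [Fintype κ] [DecidableEq κ]
  {E : C → R} {p q : C}

theorem mul_y {c : ι → C} {y x : ι → R} (h : IsSplit E p c y x) (i : ι) :
    E p * y i = y i := by
  rw [← h.sum_eq, Finset.sum_mul]
  simp [mul_assoc, h.x_mul_y, h.y_mul]

theorem x_mul {c : ι → C} {y x : ι → R} (h : IsSplit E p c y x) (i : ι) :
    x i * E p = x i := by
  rw [← h.sum_eq, Finset.mul_sum]
  simp [← mul_assoc, h.x_mul_y, h.mul_x]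

theorem idem {c : ι → C} {y x : ι → R} (h : IsSplit E p c y x) : E p * E p = E p := by
  conv_lhs => rw [← h.sum_eq, Finset.sum_mul]
  simp only [mul_assoc, h.x_mul, h.sum_eq]

theorem reindex {c : ι → C} {y x : ι → R} (h : IsSplit E p c y x) (e : κ ≃ ι) :
    IsSplit E p (c ∘ e) (y ∘ e) (x ∘ e) where
  y_mul i := h.y_mul _
  mul_x i := h.mul_x _
  x_mul_y i j := by simp [h.x_mul_y]
  sum_eq := by rw [← h.sum_eq]; exact e.sum_comp fun i => y i * x i

/-- Gluing the summands indexed by `κ` along a decomposition of `E q`. -/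
theorem contract {c : ι → C} {d : κ → C} {y x : ι ⊕ κ → R} {y' x' : κ → R}
    (h : IsSplit E p (Sum.elim c d) y x) (h' : IsSplit E q d y' x') :
    IsSplit E p (Sum.elim c fun _ : Unit => q)
      (Sum.elim (fun i => y (Sum.inl i)) fun _ => ∑ k, y (Sum.inr k) * x' k)
      (Sum.elim (fun i => x (Sum.inl i)) fun _ => ∑ k, y' k * x (Sum.inr k)) where
  y_mul := by
    rintro (i | i)
    · exact h.y_mul (Sum.inl i)
    · simp [Finset.sum_mul, mul_assoc, h'.x_mul]
  mul_x := by
    rintro (i | i)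
    · exact h.mul_x (Sum.inl i)
    · simp [Finset.mul_sum, ← mul_assoc, h'.mul_y]
  x_mul_y := by
    have hx : ∀ k, E (d k) * x (Sum.inr k) = x (Sum.inr k) := fun k => h.mul_x (Sum.inr k)
    rintro (i | i) (j | j)
    · simp [h.x_mul_y]
    · simp [Finset.mul_sum, ← mul_assoc, h.x_mul_y]
    · simp [Finset.sum_mul, mul_assoc, h.x_mul_y]
    · have key : ∀ k l, y' k * x (Sum.inr k) * (y (Sum.inr l) * x' l) =
          if k = l then y' k * x' k else 0 := by
        intro k l
        rw [mul_assoc, ← mul_assoc (x _), h.x_mul_y]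
        by_cases hkl : k = l
        · subst hkl; simp [h'.mul_x]
        · simp [hkl]
      simp [Finset.sum_mul, Finset.mul_sum, key, h'.sum_eq]
  sum_eq := by
    have hx : ∀ k, E (d k) * x (Sum.inr k) = x (Sum.inr k) := fun k => h.mul_x (Sum.inr k)
    have key : ∀ k l, y (Sum.inr k) * x' k * (y' l * x (Sum.inr l)) =
        if k = l then y (Sum.inr k) * x (Sum.inr k) else 0 := by
      intro k l
      rw [mul_assoc, ← mul_assoc (x' _), h'.x_mul_y]
      by_cases hkl : k = l
      · subst hkl; simp [hx]
      · simp [hkl]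
    rw [← h.sum_eq]
    simp [Fintype.sum_sum_type, Finset.sum_mul, Finset.mul_sum, key]

/-- Refining one summand along a decomposition of `E q`. -/
theorem expand {c : ι → C} {d : κ → C} {y x : ι ⊕ Unit → R} {y' x' : κ → R}
    (h : IsSplit E p (Sum.elim c fun _ => q) y x) (h' : IsSplit E q d y' x') :
    IsSplit E p (Sum.elim c d)
      (Sum.elim (fun i => y (Sum.inl i)) fun k => y (Sum.inr ()) * y' k)
      (Sum.elim (fun i => x (Sum.inl i)) fun k => x' k * x (Sum.inr ())) where
  y_mul := by
    rintro (i | i)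
    · exact h.y_mul (Sum.inl i)
    · simp [mul_assoc, h'.y_mul]
  mul_x := by
    rintro (i | i)
    · exact h.mul_x (Sum.inl i)
    · simp [← mul_assoc, h'.mul_x]
  x_mul_y := by
    rintro (i | i) (j | j)
    · simp [h.x_mul_y]
    · simp [← mul_assoc, h.x_mul_y]
    · simp [mul_assoc, h.x_mul_y]
    · have : x' i * x (Sum.inr ()) * (y (Sum.inr ()) * y' j) = x' i * y' j := by
        rw [mul_assoc, ← mul_assoc (x _), h.x_mul_y]
        simp [h'.mul_y]
      simp [this, h'.x_mul_y]
  sum_eq := by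
    have hx : E q * x (Sum.inr ()) = x (Sum.inr ()) := h.mul_x (Sum.inr ())
    have : ∑ k, y (Sum.inr ()) * y' k * (x' k * x (Sum.inr ())) =
        y (Sum.inr ()) * x (Sum.inr ()) := by
      calc _ = y (Sum.inr ()) * (∑ k, y' k * x' k) * x (Sum.inr ()) := by
            simp [Finset.mul_sum, Finset.sum_mul, mul_assoc]
        _ = _ := by rw [h'.sum_eq, mul_assoc, hx]
    rw [← h.sum_eq]
    simp [Fintype.sum_sum_type, this]

end IsSplit

/-- A family of additive subsets of `R` which behaves like the morphism sets of a subcategory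
with objects `C` and identities `E`. -/
structure IsHomFamily (E : C → R) (F : C → C → Set R) : Prop where
  zero_mem : ∀ p q, 0 ∈ F p q
  add_mem : ∀ {p q a b}, a ∈ F p q → b ∈ F p q → a + b ∈ F p q
  mul_mem : ∀ {p q r a b}, a ∈ F p q → b ∈ F q r → a * b ∈ F p r
  one_mem : ∀ p, E p ∈ F p p

theorem IsHomFamily.sum_mem {E : C → R} {F : C → C → Set R} (hF : IsHomFamily E F) {p q : C}
    {ι : Type} (s : Finset ι) {a : ι → R} (h : ∀ i ∈ s, a i ∈ F p q) : ∑ i ∈ s, a i ∈ F p q := by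
  classical
  induction s using Finset.induction_on with
  | empty => simpa using hF.zero_mem p q
  | insert i s hi ih =>
    rw [Finset.sum_insert hi]
    exact hF.add_mem (h i (by simp)) (ih fun j hj => h j (by simp [hj]))

variable [Fintype C] [DecidableEq C]

/-- A decomposition of `E p` with `f q` summands of type `q` for each `q`. -/
structure Row (E : C → R) (p : C) (f : C → ℕ) where
  y : (Σ q, Fin (f q)) → R
  x : (Σ q, Fin (f q)) → R
  isSplit : IsSplit E p Sigma.fst y x

/-- The components of a row belong to the family `F`. -/
def Row.Mem {E : C → R} {p : C} {f : C → ℕ} (S : Row E p f) (F : C → C → Set R) : Prop :=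
  SplitMem F p Sigma.fst S.y S.x

theorem exists_row {ι : Type} [Fintype ι] [DecidableEq ι] {E : C → R} {p : C} {c : ι → C}
    {y x : ι → R} (h : IsSplit E p c y x) (f : C → ℕ)
    (hf : ∀ q, Fintype.card {i // c i = q} = f q) :
    ∃ S : Row E p f, ∀ F, S.Mem F ↔ SplitMem F p c y x := by
  obtain ⟨e, he⟩ := exists_sigma_equiv c f hf
  refine ⟨⟨y ∘ e, x ∘ e, he ▸ h.reindex e⟩, fun F => ?_⟩
  have := splitMem_reindex (F := F) (p := p) (c := c) (y := y) (x := x) e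
  rw [he] at this
  exact this

theorem card_sigma_fiber (f : C → ℕ) (q : C) :
    Fintype.card {i : Σ q, Fin (f q) // i.1 = q} = f q := by
  rw [Fintype.card_congr (Equiv.sigmaSubtype (β := fun q => Fin (f q)) q)]
  simp

theorem Row.exists_contract {E : C → R} {p q : C} {f g : C → ℕ} (S : Row E p (f + g))
    (T : Row E q g) : ∃ S' : Row E p (f + Pi.single q 1),
      ∀ F, IsHomFamily E F → T.Mem F → (S'.Mem F ↔ S.Mem F) := by
  obtain ⟨e, he⟩ := exists_sigma_equiv (C := C)
    (Sum.elim (Sigma.fst : (Σ q, Fin (f q)) → C) (Sigma.fst : (Σ q, Fin (g q)) → C)) (f + g)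
    (fun q => by rw [card_sum_fiber, card_sigma_fiber, card_sigma_fiber]; rfl)
  have he' : Sigma.fst ∘ e.symm = Sum.elim (Sigma.fst : (Σ q, Fin (f q)) → C)
      (Sigma.fst : (Σ q, Fin (g q)) → C) := by
    rw [← he, Function.comp_assoc, Equiv.self_comp_symm, Function.comp_id]
  have hS := S.isSplit.reindex e.symm
  rw [he'] at hS
  obtain ⟨S', hS'⟩ := exists_row (hS.contract T.isSplit) (f + Pi.single q 1)
    (fun q => by rw [card_sum_fiber, card_sigma_fiber, card_unit_fiber]; rfl)
  refine ⟨S', fun F hF hT => ?_⟩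
  rw [hS', Row.Mem, ← splitMem_reindex e.symm, he']
  constructor
  · rintro h (i | k)
    · exact h (Sum.inl i)
    · have h1 := h (Sum.inr ())
      have key : ∀ k l, T.x k * T.y l = if k = l then E k.1 else 0 := T.isSplit.x_mul_y
      have e1 : (∑ l, (S.y ∘ e.symm) (Sum.inr l) * T.x l) * T.y k
          = (S.y ∘ e.symm) (Sum.inr k) := by
        have := hS.y_mul (Sum.inr k)
        rw [Sum.elim_inr] at this
        simp only [Finset.sum_mul, mul_assoc, key, mul_ite, mul_zero, Finset.sum_ite_eq',
          Finset.mem_univ, if_true, this]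
      have e2 : T.x k * (∑ l, T.y l * (S.x ∘ e.symm) (Sum.inr l))
          = (S.x ∘ e.symm) (Sum.inr k) := by
        have := hS.mul_x (Sum.inr k)
        rw [Sum.elim_inr] at this
        simp only [Finset.mul_sum, ← mul_assoc, key, ite_mul, zero_mul, Finset.sum_ite_eq,
          Finset.mem_univ, if_true, this]
      exact ⟨e1 ▸ hF.mul_mem h1.1 (hT k).1, e2 ▸ hF.mul_mem (hT k).2 h1.2⟩
  · rintro h (i | k)
    · exact h (Sum.inl i)
    · exact ⟨hF.sum_mem _ fun l _ => hF.mul_mem (h (Sum.inr l)).1 (hT l).2,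
        hF.sum_mem _ fun l _ => hF.mul_mem (hT l).1 (h (Sum.inr l)).2⟩

theorem Row.exists_expand {E : C → R} {p q : C} {f g : C → ℕ} (S : Row E p (f + Pi.single q 1))
    (T : Row E q g) : ∃ S' : Row E p (f + g),
      ∀ F, IsHomFamily E F → T.Mem F → (S'.Mem F ↔ S.Mem F) := by
  obtain ⟨e, he⟩ := exists_sigma_equiv (C := C)
    (Sum.elim (Sigma.fst : (Σ q, Fin (f q)) → C) (fun _ : Unit => q)) (f + Pi.single q 1)
    (fun q => by rw [card_sum_fiber, card_sigma_fiber, card_unit_fiber]; rfl)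
  have he' : Sigma.fst ∘ e.symm = Sum.elim (Sigma.fst : (Σ q, Fin (f q)) → C)
      (fun _ : Unit => q) := by
    rw [← he, Function.comp_assoc, Equiv.self_comp_symm, Function.comp_id]
  have hS := S.isSplit.reindex e.symm
  rw [he'] at hS
  obtain ⟨S', hS'⟩ := exists_row (hS.expand T.isSplit) (f + g)
    (fun q => by rw [card_sum_fiber, card_sigma_fiber, card_sigma_fiber]; rfl)
  refine ⟨S', fun F hF hT => ?_⟩
  rw [hS', Row.Mem, ← splitMem_reindex e.symm, he']
  constructor
  · rintro h (i | k)
    · exact h (Sum.inl i)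
    · have e1 : ∑ l, (S.y ∘ e.symm) (Sum.inr ()) * T.y l * T.x l
          = (S.y ∘ e.symm) (Sum.inr ()) := by
        have := hS.y_mul (Sum.inr ())
        rw [Sum.elim_inr] at this
        simp only [mul_assoc, ← Finset.mul_sum, T.isSplit.sum_eq, this]
      have e2 : ∑ l, T.y l * (T.x l * (S.x ∘ e.symm) (Sum.inr ()))
          = (S.x ∘ e.symm) (Sum.inr ()) := by
        have := hS.mul_x (Sum.inr ())
        rw [Sum.elim_inr] at this
        simp only [← mul_assoc, ← Finset.sum_mul, T.isSplit.sum_eq, this]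
      exact ⟨e1 ▸ hF.sum_mem _ fun l _ => hF.mul_mem (h (Sum.inr l)).1 (hT l).2,
        e2 ▸ hF.sum_mem _ fun l _ => hF.mul_mem (hT l).1 (h (Sum.inr l)).2⟩
  · rintro h (i | k)
    · exact h (Sum.inl i)
    · exact ⟨hF.mul_mem (h (Sum.inr ())).1 (hT k).1, hF.mul_mem (hT k).2 (h (Sum.inr ())).2⟩

end Splitting

section Elimination

variable {R : Type} [Ring R] {E : Fin 3 → R} {v z w f : Fin 3 → ℕ}
  {Q : (Fin 3 → Fin 3 → Set R) → Prop}

/-- There are rows of the prescribed shapes for the three objects, whose components generate the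
same families of morphisms as the condition `Q`. -/
def Reach (E : Fin 3 → R) (v z w : Fin 3 → ℕ) (Q : (Fin 3 → Fin 3 → Set R) → Prop) : Prop :=
  ∃ (a : Row E 0 v) (b : Row E 1 z) (c : Row E 2 w),
    ∀ F, IsHomFamily E F → ((a.Mem F ∧ b.Mem F ∧ c.Mem F) ↔ Q F)

namespace Reach

theorem z_expand_v (h : Reach E v (f + Pi.single 0 1) w Q) : Reach E v (f + v) w Q := by
  obtain ⟨a, b, c, h⟩ := h
  obtain ⟨b', hb⟩ := b.exists_expand a
  refine ⟨a, b', c, fun F hF => ?_⟩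
  have := hb F hF
  rw [← h F hF]
  tauto

theorem w_expand_v (h : Reach E v z (f + Pi.single 0 1) Q) : Reach E v z (f + v) Q := by
  obtain ⟨a, b, c, h⟩ := h
  obtain ⟨c', hc⟩ := c.exists_expand a
  refine ⟨a, b, c', fun F hF => ?_⟩
  have := hc F hF
  rw [← h F hF]
  tauto

theorem w_expand_z (h : Reach E v z (f + Pi.single 1 1) Q) : Reach E v z (f + z) Q := by
  obtain ⟨a, b, c, h⟩ := h
  obtain ⟨c', hc⟩ := c.exists_expand b
  refine ⟨a, b, c', fun F hF => ?_⟩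
  have := hc F hF
  rw [← h F hF]
  tauto

theorem v_expand_z (h : Reach E (f + Pi.single 1 1) z w Q) : Reach E (f + z) z w Q := by
  obtain ⟨a, b, c, h⟩ := h
  obtain ⟨a', ha⟩ := a.exists_expand b
  refine ⟨a', b, c, fun F hF => ?_⟩
  have := ha F hF
  rw [← h F hF]
  tauto

theorem z_contract_w (h : Reach E v (f + w) w Q) : Reach E v (f + Pi.single 2 1) w Q := by
  obtain ⟨a, b, c, h⟩ := h
  obtain ⟨b', hb⟩ := b.exists_contract c
  refine ⟨a, b', c, fun F hF => ?_⟩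
  have := hb F hF
  rw [← h F hF]
  tauto

theorem w_contract_z (h : Reach E v z (f + z) Q) : Reach E v z (f + Pi.single 1 1) Q := by
  obtain ⟨a, b, c, h⟩ := h
  obtain ⟨c', hc⟩ := c.exists_contract b
  refine ⟨a, b, c', fun F hF => ?_⟩
  have := hc F hF
  rw [← h F hF]
  tauto

theorem z_expand_v_all {k b c : ℕ} (m : ℕ) (h : Reach E ![0, 1, k] ![m, b, c] w Q) :
    Reach E ![0, 1, k] ![0, b + m, c + m * k] w Q := by
  induction m generalizing b c with
  | zero => simpa using h
  | succ m ih =>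
    have h1 : (![m + 1, b, c] : Fin 3 → ℕ) = ![m, b, c] + Pi.single 0 1 := by
      ext i; fin_cases i <;> simp
    rw [h1] at h
    have h2 := h.z_expand_v
    have h3 : (![m, b, c] : Fin 3 → ℕ) + ![0, 1, k] = ![m, b + 1, c + k] := by
      ext i; fin_cases i <;> simp
    rw [h3] at h2
    convert ih h2 using 3 <;> ring_nf

theorem w_expand_v_all {k b c : ℕ} (m : ℕ) (h : Reach E ![0, 1, k] z ![m, b, c] Q) :
    Reach E ![0, 1, k] z ![0, b + m, c + m * k] Q := by
  induction m generalizing b c with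
  | zero => simpa using h
  | succ m ih =>
    have h1 : (![m + 1, b, c] : Fin 3 → ℕ) = ![m, b, c] + Pi.single 0 1 := by
      ext i; fin_cases i <;> simp
    rw [h1] at h
    have h2 := h.w_expand_v
    have h3 : (![m, b, c] : Fin 3 → ℕ) + ![0, 1, k] = ![m, b + 1, c + k] := by
      ext i; fin_cases i <;> simp
    rw [h3] at h2
    convert ih h2 using 3 <;> ring_nf

/-- The Euclidean algorithm in the monoid `SL₂(ℕ)`, performed on the rows of the objects
`1` and `2`. -/
theorem euclid {N : ℕ} (hN : 0 < N) (a b c d : ℕ) (hdet : a * d = 1 + b * c)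
    (h : Reach E v ![0, 1 + b, N * a] ![0, d, 1 + N * c] Q) :
    Reach E v ![0, 1, N] ![0, 1, 1] Q := by
  induction hs : a + b + c + d using Nat.strong_induction_on generalizing a b c d with
  | _ S ih =>
    subst hs
    have hd : 0 < d := Nat.pos_of_ne_zero (by rintro rfl; linarith [Nat.zero_le (b * c)])
    have ha : 0 < a := Nat.pos_of_ne_zero (by rintro rfl; linarith [Nat.zero_le (b * c)])
    rcases lt_or_ge c a with hca | hac
    · rcases le_or_gt d b with hdb | hbd
      · obtain ⟨a', rfl⟩ := Nat.exists_eq_add_of_lt hca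
        obtain ⟨b', rfl⟩ := Nat.exists_eq_add_of_le hdb
        obtain ⟨M, rfl⟩ := Nat.exists_eq_add_of_lt hN
        refine ih _ ?_ (a' + 1) b' c d (by nlinarith) ?_ rfl
        · omega
        · have e1 : (![0, 1 + (d + b'), (0 + M + 1) * (c + a' + 1)] : Fin 3 → ℕ) =
              ![0, 1 + b', (0 + M + 1) * a' + M] + ![0, d, 1 + (0 + M + 1) * c] := by
            ext i; fin_cases i <;> simp <;> ring
          have e2 : (![0, 1 + b', (0 + M + 1) * (a' + 1)] : Fin 3 → ℕ) =
              ![0, 1 + b', (0 + M + 1) * a' + M] + Pi.single 2 1 := by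
            ext i; fin_cases i <;> simp; ring
          rw [e1] at h
          rw [e2]
          exact h.z_contract_w
      · have hb : b = 0 := by nlinarith
        have hc : c = 0 := by nlinarith
        subst hb hc
        have : a = 1 ∧ d = 1 := by simpa using hdet
        obtain ⟨rfl, rfl⟩ := this
        simpa using h
    · have hbd : b < d := by nlinarith
      obtain ⟨c', rfl⟩ := Nat.exists_eq_add_of_le hac
      obtain ⟨d', rfl⟩ := Nat.exists_eq_add_of_lt hbd
      refine ih _ ?_ a b c' (d' + 1) (by nlinarith) ?_ rfl
      · omega
      · have e1 : (![0, b + d' + 1, 1 + N * (a + c')] : Fin 3 → ℕ) =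
            ![0, d', 1 + N * c'] + ![0, 1 + b, N * a] := by
          ext i; fin_cases i <;> simp <;> ring
        have e2 : (![0, d' + 1, 1 + N * c'] : Fin 3 → ℕ) =
            ![0, d', 1 + N * c'] + Pi.single 1 1 := by
          ext i; fin_cases i <;> simp
        rw [e1] at h
        rw [e2]
        exact h.w_contract_z

theorem eliminate {N t m k k' : ℕ} (hN : 0 < N) (hm : m + t = N) (hk : k * t = 1 + N * k')
    (h : Reach E ![0, 1, k] ![m, 1, 1] ![t, 0, 0] Q) :
    Reach E ![0, 0, k + N] ![0, 0, N] ![0, 0, 1 + N] Q := by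
  have hkk : k' ≤ k := by nlinarith
  obtain ⟨j, rfl⟩ := Nat.exists_eq_add_of_le hkk
  have h1 := (h.z_expand_v_all m).w_expand_v_all t
  have e1 : (![0, 1 + m, 1 + m * (k' + j)] : Fin 3 → ℕ) = ![0, 1 + m, N * j] := by
    have : 1 + m * (k' + j) = N * j := by subst hm; nlinarith
    rw [this]
  have e2 : (![0, 0 + t, 0 + t * (k' + j)] : Fin 3 → ℕ) = ![0, t, 1 + N * k'] := by
    rw [← hk]; simp [mul_comm]
  rw [e1, e2] at h1
  have h2 := h1.euclid hN j m k' t (by subst hm; nlinarith)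
  obtain ⟨M, rfl⟩ := Nat.exists_eq_add_of_lt hN
  have e3 : (![0, 1, 0 + M + 1] : Fin 3 → ℕ) = ![0, 0, M] + ![0, 1, 1] := by
    ext i; fin_cases i <;> simp
  have e4 : (![0, 0, M] : Fin 3 → ℕ) + Pi.single 2 1 = ![0, 0, 0 + M + 1] := by
    ext i; fin_cases i <;> simp
  rw [e3] at h2
  have h3 := h2.z_contract_w
  rw [e4] at h3
  have e5 : (![0, 1, 1] : Fin 3 → ℕ) = ![0, 0, 1] + Pi.single 1 1 := by
    ext i; fin_cases i <;> simp
  have e6 : (![0, 1, k' + j] : Fin 3 → ℕ) = ![0, 0, k' + j] + Pi.single 1 1 := by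
    ext i; fin_cases i <;> simp
  rw [e5] at h3
  have h4 := h3.w_expand_z
  rw [e6] at h4
  have h5 := h4.v_expand_z
  convert h5 using 1 <;> ext i <;> fin_cases i <;> simp

end Reach

end Elimination

section Caterpillar

variable {R : Type} [Ring R] {t m : ℕ}

/-- Elements of a ring satisfying the relations of the Leavitt algebra of type `1 + t + m`. -/
structure IsLeavittFamily {ι : Type} [Fintype ι] [DecidableEq ι] (Y X : ι → R) : Prop where
  x_mul_y : ∀ i j, X i * Y j = if i = j then 1 else 0
  sum_eq : ∑ i, Y i * X i = 1

/-- The idempotent of the summands indexed by `Fin t`. -/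
def idemW (Y X : Unit ⊕ Fin t ⊕ Fin m → R) : R :=
  ∑ i, Y (Sum.inr (Sum.inl i)) * X (Sum.inr (Sum.inl i))

/-- The idempotent of the summands indexed by `Fin m`. -/
def idemM (Y X : Unit ⊕ Fin t ⊕ Fin m → R) : R :=
  ∑ i, Y (Sum.inr (Sum.inr i)) * X (Sum.inr (Sum.inr i))

/-- The idempotent left over after splitting off `k` copies of `idemW` along the powers
of `Y (Sum.inl ())`. -/
def idemZ (k : ℕ) (Y X : Unit ⊕ Fin t ⊕ Fin m → R) : R :=
  ∑ j ∈ Finset.range k, Y (Sum.inl ()) ^ j * idemM Y X * X (Sum.inl ()) ^ j +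
    Y (Sum.inl ()) ^ k * X (Sum.inl ()) ^ k

/-- The idempotents of the three objects `V`, `Z`, `W` with `V ≅ Z ⊕ W ^ k`. -/
def idems (k : ℕ) (Y X : Unit ⊕ Fin t ⊕ Fin m → R) : Fin 3 → R :=
  ![1, idemZ k Y X, idemW Y X]

namespace IsLeavittFamily

variable {Y X : Unit ⊕ Fin t ⊕ Fin m → R}

theorem idem_sum (h : IsLeavittFamily Y X) :
    Y (Sum.inl ()) * X (Sum.inl ()) + (idemW Y X + idemM Y X) = 1 := by
  rw [← h.sum_eq]
  simp [Fintype.sum_sum_type, idemW, idemM]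

theorem idemZ_add (h : IsLeavittFamily Y X) (k : ℕ) :
    idemZ k Y X + ∑ j ∈ Finset.range k, Y (Sum.inl ()) ^ j * idemW Y X * X (Sum.inl ()) ^ j
      = 1 := by
  induction k with
  | zero => simp [idemZ]
  | succ k ih =>
    have key : Y (Sum.inl ()) ^ k * X (Sum.inl ()) ^ k =
        Y (Sum.inl ()) ^ k * idemM Y X * X (Sum.inl ()) ^ k +
        Y (Sum.inl ()) ^ (k + 1) * X (Sum.inl ()) ^ (k + 1) +
        Y (Sum.inl ()) ^ k * idemW Y X * X (Sum.inl ()) ^ k := by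
      conv_lhs => rw [← mul_one (Y (Sum.inl ()) ^ k), ← h.idem_sum]
      rw [pow_succ, pow_succ']
      noncomm_ring
    rw [← ih]
    simp only [idemZ, Finset.sum_range_succ]
    rw [key]
    abel

theorem idemW_mul_y (h : IsLeavittFamily Y X) (i : Fin t) :
    idemW Y X * Y (Sum.inr (Sum.inl i)) = Y (Sum.inr (Sum.inl i)) := by
  simp [idemW, Finset.sum_mul, mul_assoc, h.x_mul_y]

theorem x_mul_idemW (h : IsLeavittFamily Y X) (i : Fin t) :
    X (Sum.inr (Sum.inl i)) * idemW Y X = X (Sum.inr (Sum.inl i)) := by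
  simp [idemW, Finset.mul_sum, ← mul_assoc, h.x_mul_y]

theorem idemW_mul_self (h : IsLeavittFamily Y X) : idemW Y X * idemW Y X = idemW Y X := by
  nth_rewrite 2 [idemW]
  simp only [Finset.mul_sum, ← mul_assoc, h.idemW_mul_y]
  rfl

theorem idemW_mul_root (h : IsLeavittFamily Y X) : idemW Y X * Y (Sum.inl ()) = 0 := by
  simp [idemW, Finset.sum_mul, mul_assoc, h.x_mul_y]

theorem root_mul_idemW (h : IsLeavittFamily Y X) : X (Sum.inl ()) * idemW Y X = 0 := by
  simp [idemW, Finset.mul_sum, ← mul_assoc, h.x_mul_y]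

theorem x_pow_mul_y_pow (h : IsLeavittFamily Y X) (j : ℕ) :
    X (Sum.inl ()) ^ j * Y (Sum.inl ()) ^ j = 1 := by
  induction j with
  | zero => simp
  | succ j ih =>
    rw [pow_succ, pow_succ', mul_assoc, ← mul_assoc (X _), h.x_mul_y]
    simpa using ih

theorem limb_mul (h : IsLeavittFamily Y X) (i j : ℕ) :
    idemW Y X * X (Sum.inl ()) ^ i * (Y (Sum.inl ()) ^ j * idemW Y X) =
      if i = j then idemW Y X else 0 := by
  rcases lt_trichotomy i j with hij | rfl | hij
  · obtain ⟨d, rfl⟩ := Nat.exists_eq_add_of_lt hij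
    have : idemW Y X * X (Sum.inl ()) ^ i * (Y (Sum.inl ()) ^ (i + d + 1) * idemW Y X) =
        idemW Y X * (X (Sum.inl ()) ^ i * Y (Sum.inl ()) ^ i) * Y (Sum.inl ()) *
          Y (Sum.inl ()) ^ d * idemW Y X := by
      rw [add_assoc, pow_add, add_comm d 1, pow_add]; noncomm_ring
    rw [this, h.x_pow_mul_y_pow, mul_one, h.idemW_mul_root]
    simp [hij.ne]
  · rw [mul_assoc, ← mul_assoc (X _ ^ i), h.x_pow_mul_y_pow]
    simp [h.idemW_mul_self]
  · obtain ⟨d, rfl⟩ := Nat.exists_eq_add_of_lt hij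
    have : idemW Y X * X (Sum.inl ()) ^ (j + d + 1) * (Y (Sum.inl ()) ^ j * idemW Y X) =
        idemW Y X * X (Sum.inl ()) ^ d * X (Sum.inl ()) *
          (X (Sum.inl ()) ^ j * Y (Sum.inl ()) ^ j) * idemW Y X := by
      rw [add_assoc, add_comm j, pow_add, pow_add]; noncomm_ring
    rw [this, h.x_pow_mul_y_pow, mul_one, mul_assoc, h.root_mul_idemW]
    simp [hij.ne']

theorem idemZ_mul_limb (h : IsLeavittFamily Y X) {k j : ℕ} (hj : j < k) :
    idemZ k Y X * (Y (Sum.inl ()) ^ j * idemW Y X) = 0 := by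
  rw [eq_sub_of_add_eq (h.idemZ_add k), sub_mul, Finset.sum_mul, sub_eq_zero]
  rw [Finset.sum_eq_single_of_mem j (by simpa using hj)]
  · rw [mul_assoc (Y _ ^ j), mul_assoc (Y _ ^ j), h.limb_mul]; simp
  · intro i _ hij
    rw [mul_assoc (Y _ ^ i), mul_assoc (Y _ ^ i), h.limb_mul]; simp [hij]

theorem limb_mul_idemZ (h : IsLeavittFamily Y X) {k j : ℕ} (hj : j < k) :
    idemW Y X * X (Sum.inl ()) ^ j * idemZ k Y X = 0 := by
  rw [eq_sub_of_add_eq (h.idemZ_add k), mul_sub, Finset.mul_sum, sub_eq_zero]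
  rw [Finset.sum_eq_single_of_mem j (by simpa using hj)]
  · rw [← mul_assoc, h.limb_mul]; simp
  · intro i _ hij
    rw [← mul_assoc, h.limb_mul]; simp [hij.symm]

theorem idemZ_mul_self (h : IsLeavittFamily Y X) (k : ℕ) :
    idemZ k Y X * idemZ k Y X = idemZ k Y X := by
  nth_rewrite 1 [eq_sub_of_add_eq (h.idemZ_add k)]
  rw [sub_mul, one_mul, Finset.sum_mul, Finset.sum_eq_zero, sub_zero]
  intro j hj
  rw [mul_assoc (Y _ ^ j), mul_assoc (Y _ ^ j), h.limb_mul_idemZ (by simpa using hj), mul_zero]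

theorem isSplit_v (h : IsLeavittFamily Y X) (k : ℕ) :
    IsSplit (idems k Y X) 0 (Sum.elim (fun _ : Unit => 1) fun _ : Fin k => 2)
      (Sum.elim (fun _ => idemZ k Y X) fun j => Y (Sum.inl ()) ^ j.1 * idemW Y X)
      (Sum.elim (fun _ => idemZ k Y X) fun j => idemW Y X * X (Sum.inl ()) ^ j.1) where
  y_mul := by
    rintro (i | i)
    · simp [idems, h.idemZ_mul_self]
    · simp [idems, mul_assoc, h.idemW_mul_self]
  mul_x := by
    rintro (i | i)
    · simp [idems, h.idemZ_mul_self]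
    · simp [idems, ← mul_assoc, h.idemW_mul_self]
  x_mul_y := by
    rintro (i | i) (j | j)
    · simp [idems, h.idemZ_mul_self]
    · simp [h.idemZ_mul_limb j.2]
    · simp [h.limb_mul_idemZ i.2]
    · simp [idems, h.limb_mul, Fin.ext_iff]
  sum_eq := by
    have key : ∀ j : ℕ, Y (Sum.inl ()) ^ j * idemW Y X * (idemW Y X * X (Sum.inl ()) ^ j) =
        Y (Sum.inl ()) ^ j * idemW Y X * X (Sum.inl ()) ^ j := fun j => by
      rw [mul_assoc, ← mul_assoc (idemW Y X), h.idemW_mul_self, mul_assoc]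
    simp only [Fintype.sum_sum_type, Sum.elim_inl, Sum.elim_inr, Finset.univ_unique,
      Finset.sum_singleton, h.idemZ_mul_self, key]
    rw [Fin.sum_univ_eq_sum_range fun j => Y (Sum.inl ()) ^ j * idemW Y X * X (Sum.inl ()) ^ j]
    exact h.idemZ_add k

theorem isSplit_w (h : IsLeavittFamily Y X) (k : ℕ) :
    IsSplit (idems k Y X) 2 (fun _ : Fin t => 0)
      (fun i => Y (Sum.inr (Sum.inl i))) (fun i => X (Sum.inr (Sum.inl i))) where
  y_mul i := by simp [idems]
  mul_x i := by simp [idems]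
  x_mul_y i j := by simp [idems, h.x_mul_y]
  sum_eq := rfl

theorem idemZ_add_succ (h : IsLeavittFamily Y X) (k : ℕ) :
    idemM Y X + (Y (Sum.inl ()) * idemZ k Y X * X (Sum.inl ()) +
      Y (Sum.inl ()) ^ k * idemW Y X * X (Sum.inl ()) ^ k) = idemZ k Y X := by
  have h1 : ∑ j ∈ Finset.range (k + 1), Y (Sum.inl ()) ^ j * idemW Y X * X (Sum.inl ()) ^ j =
      Y (Sum.inl ()) * (1 - idemZ k Y X) * X (Sum.inl ()) + idemW Y X := by
    rw [Finset.sum_range_succ', ← eq_sub_of_add_eq' (h.idemZ_add k), Finset.mul_sum,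
      Finset.sum_mul]
    congr 1
    · exact Finset.sum_congr rfl fun j _ => by rw [pow_succ', pow_succ]; noncomm_ring
    · simp
  rw [Finset.sum_range_succ, eq_sub_of_add_eq' (h.idemZ_add k)] at h1
  have h2 := h.idem_sum
  rw [mul_sub, sub_mul, mul_one] at h1
  rw [eq_sub_of_add_eq' h1, ← h2]
  abel

theorem isSplit_z (h : IsLeavittFamily Y X) {k : ℕ} (hk : 0 < k) :
    IsSplit (idems k Y X) 1
      (Sum.elim (fun _ : Fin m => 0) (Sum.elim (fun _ : Unit => 1) fun _ : Unit => 2))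
      (Sum.elim (fun i => Y (Sum.inr (Sum.inr i)))
        (Sum.elim (fun _ => Y (Sum.inl ()) * idemZ k Y X)
          fun _ => Y (Sum.inl ()) ^ k * idemW Y X))
      (Sum.elim (fun i => X (Sum.inr (Sum.inr i)))
        (Sum.elim (fun _ => idemZ k Y X * X (Sum.inl ()))
          fun _ => idemW Y X * X (Sum.inl ()) ^ k)) where
  y_mul := by
    rintro (i | i | i)
    · simp [idems]
    · simp [idems, mul_assoc, h.idemZ_mul_self]
    · simp [idems, mul_assoc, h.idemW_mul_self]
  mul_x := by
    rintro (i | i | i)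
    · simp [idems]
    · simp [idems, ← mul_assoc, h.idemZ_mul_self]
    · simp [idems, ← mul_assoc, h.idemW_mul_self]
  x_mul_y := by
    obtain ⟨l, rfl⟩ := Nat.exists_eq_add_of_lt hk
    have e0 : X (Sum.inl ()) * Y (Sum.inl ()) = 1 := by simp [h.x_mul_y]
    have e1 : ∀ a b, a * X (Sum.inl ()) * (Y (Sum.inl ()) * b) = a * b := fun a b => by
      rw [mul_assoc, ← mul_assoc (X _), e0, one_mul]
    rintro (i | i | i) (j | j | j)
    · simp [idems, h.x_mul_y]
    · simp [← mul_assoc, h.x_mul_y]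
    · simp [← mul_assoc, h.x_mul_y, pow_succ']
    · simp [mul_assoc, h.x_mul_y]
    · simp [idems, e1, h.idemZ_mul_self]
    · simp only [Sum.elim_inl, Sum.elim_inr, pow_succ', mul_assoc (Y (Sum.inl ())), e1]
      simp [h.idemZ_mul_limb]
    · simp [mul_assoc, h.x_mul_y, pow_succ]
    · simp only [Sum.elim_inl, Sum.elim_inr, pow_succ, ← mul_assoc (idemW Y X), e1]
      simp [h.limb_mul_idemZ]
    · simp [idems, h.limb_mul]
  sum_eq := by
    have key : ∀ a b c : R, c * c = c → a * c * (c * b) = a * c * b := fun a b c hc => by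
      rw [mul_assoc, ← mul_assoc c, hc, mul_assoc]
    simp only [Fintype.sum_sum_type, Sum.elim_inl, Sum.elim_inr, Finset.univ_unique,
      Finset.sum_singleton, key _ _ _ (h.idemZ_mul_self k), key _ _ _ h.idemW_mul_self]
    exact h.idemZ_add_succ k

/-- The condition that the components of the rows of `V`, `Z` and `W` belong to `F`. -/
def RowsMem (k : ℕ) (Y X : Unit ⊕ Fin t ⊕ Fin m → R) (F : Fin 3 → Fin 3 → Set R) : Prop :=
  SplitMem F 0 (Sum.elim (fun _ : Unit => 1) fun _ : Fin k => 2)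
      (Sum.elim (fun _ => idemZ k Y X) fun j => Y (Sum.inl ()) ^ j.1 * idemW Y X)
      (Sum.elim (fun _ => idemZ k Y X) fun j => idemW Y X * X (Sum.inl ()) ^ j.1) ∧
  SplitMem F 1
      (Sum.elim (fun _ : Fin m => 0) (Sum.elim (fun _ : Unit => 1) fun _ : Unit => 2))
      (Sum.elim (fun i => Y (Sum.inr (Sum.inr i)))
        (Sum.elim (fun _ => Y (Sum.inl ()) * idemZ k Y X)
          fun _ => Y (Sum.inl ()) ^ k * idemW Y X))
      (Sum.elim (fun i => X (Sum.inr (Sum.inr i)))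
        (Sum.elim (fun _ => idemZ k Y X * X (Sum.inl ()))
          fun _ => idemW Y X * X (Sum.inl ()) ^ k)) ∧
  SplitMem F 2 (fun _ : Fin t => 0)
      (fun i => Y (Sum.inr (Sum.inl i))) (fun i => X (Sum.inr (Sum.inl i)))

theorem reach (h : IsLeavittFamily Y X) {k : ℕ} (hk : 0 < k) :
    Reach (idems k Y X) ![0, 1, k] ![m, 1, 1] ![t, 0, 0] (RowsMem k Y X) := by
  obtain ⟨a, ha⟩ := exists_row (h.isSplit_v k) ![0, 1, k] (fun q => by
    rw [card_sum_fiber]; fin_cases q <;> simp)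
  obtain ⟨b, hb⟩ := exists_row (h.isSplit_z hk) ![m, 1, 1] (fun q => by
    rw [card_sum_fiber, card_sum_fiber]; fin_cases q <;> simp)
  obtain ⟨c, hc⟩ := exists_row (h.isSplit_w k) ![t, 0, 0] (fun q => by
    fin_cases q <;> simp)
  exact ⟨a, b, c, fun F _ => by rw [ha, hb, hc, RowsMem]⟩

/-- A family of morphisms containing the rows of `V`, `Z` and `W` contains the generators. -/
theorem mem_of_rowsMem (h : IsLeavittFamily Y X) {k : ℕ} (hk : 0 < k)
    {F : Fin 3 → Fin 3 → Set R} (hF : IsHomFamily (idems k Y X) F) (hR : RowsMem k Y X F) :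
    (idemW Y X ∈ F 0 2 ∧ idemW Y X ∈ F 2 0) ∧ ∀ i, Y i ∈ F 0 0 ∧ X i ∈ F 0 0 := by
  obtain ⟨hv, hz, hw⟩ := hR
  have hW : idemW Y X ∈ F 0 2 ∧ idemW Y X ∈ F 2 0 := by
    simpa using hv (Sum.inr ⟨0, hk⟩)
  have hZ : idemZ k Y X ∈ F 0 1 ∧ idemZ k Y X ∈ F 1 0 := hv (Sum.inl ())
  have hlimb : ∀ j, j < k → Y (Sum.inl ()) ^ j * idemW Y X ∈ F 0 2 ∧
    idemW Y X * X (Sum.inl ()) ^ j ∈ F 2 0 := fun j hj => hv (Sum.inr ⟨j, hj⟩)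
  have hzz : Y (Sum.inl ()) * idemZ k Y X ∈ F 1 1 ∧ idemZ k Y X * X (Sum.inl ()) ∈ F 1 1 :=
    hz (Sum.inr (Sum.inl ()))
  have hzw : Y (Sum.inl ()) ^ k * idemW Y X ∈ F 1 2 ∧ idemW Y X * X (Sum.inl ()) ^ k ∈ F 2 1 :=
    hz (Sum.inr (Sum.inr ()))
  have hlimb' : ∀ j, j ≤ k → Y (Sum.inl ()) ^ j * idemW Y X ∈ F 0 2 ∧
      idemW Y X * X (Sum.inl ()) ^ j ∈ F 2 0 := by
    intro j hj
    rcases hj.lt_or_eq with hj | rfl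
    · exact hlimb j hj
    · have e1 : idemZ j Y X * (Y (Sum.inl ()) ^ j * idemW Y X) = Y (Sum.inl ()) ^ j * idemW Y X :=
        (h.isSplit_z hk).mul_y (Sum.inr (Sum.inr ()))
      have e2 : idemW Y X * X (Sum.inl ()) ^ j * idemZ j Y X = idemW Y X * X (Sum.inl ()) ^ j :=
        (h.isSplit_z hk).x_mul (Sum.inr (Sum.inr ()))
      exact ⟨e1 ▸ hF.mul_mem hZ.1 hzw.1, e2 ▸ hF.mul_mem hzw.2 hZ.2⟩
  have hq : ∀ j : ℕ, Y (Sum.inl ()) ^ j * idemW Y X * (idemW Y X * X (Sum.inl ()) ^ j) =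
      Y (Sum.inl ()) ^ j * idemW Y X * X (Sum.inl ()) ^ j := fun j => by
    rw [mul_assoc, ← mul_assoc (idemW Y X), h.idemW_mul_self, mul_assoc]
  refine ⟨hW, ?_⟩
  rintro (⟨⟩ | i | i)
  · have e1 := (h.isSplit_z hk).mul_y (Sum.inr (Sum.inl ()))
    have e2 := (h.isSplit_z hk).x_mul (Sum.inr (Sum.inl ()))
    have m1 := hF.mul_mem (hF.mul_mem hZ.1 hzz.1) hZ.2
    have m2 := hF.mul_mem (hF.mul_mem hZ.1 hzz.2) hZ.2
    have r1 : idemZ k Y X * (Y (Sum.inl ()) * idemZ k Y X) * idemZ k Y X =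
        Y (Sum.inl ()) * idemZ k Y X := by
      rw [show idemZ k Y X * (Y (Sum.inl ()) * idemZ k Y X) = Y (Sum.inl ()) * idemZ k Y X from e1,
        mul_assoc, h.idemZ_mul_self]
    have r2 : idemZ k Y X * (idemZ k Y X * X (Sum.inl ())) * idemZ k Y X =
        idemZ k Y X * X (Sum.inl ()) := by
      rw [mul_assoc, show idemZ k Y X * X (Sum.inl ()) * idemZ k Y X =
        idemZ k Y X * X (Sum.inl ()) from e2, ← mul_assoc, h.idemZ_mul_self]
    rw [r1] at m1
    rw [r2] at m2
    constructor
    · rw [← mul_one (Y (Sum.inl ())), ← h.idemZ_add k, mul_add, Finset.mul_sum]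
      refine hF.add_mem m1 (hF.sum_mem _ fun j hj => ?_)
      have hj' : j < k := by simpa using hj
      have := hF.mul_mem (hlimb' (j + 1) hj').1 (hlimb j hj').2
      rw [pow_succ', mul_assoc (Y _), mul_assoc (Y _), hq] at this
      exact this
    · rw [← one_mul (X (Sum.inl ())), ← h.idemZ_add k, add_mul, Finset.sum_mul]
      refine hF.add_mem m2 (hF.sum_mem _ fun j hj => ?_)
      have hj' : j < k := by simpa using hj
      have := hF.mul_mem (hlimb j hj').1 (hlimb' (j + 1) hj').2
      rw [pow_succ, ← mul_assoc (idemW Y X), ← mul_assoc, hq] at this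
      exact this
  · exact ⟨h.idemW_mul_y i ▸ hF.mul_mem hW.1 (hw i).1,
      h.x_mul_idemW i ▸ hF.mul_mem (hw i).2 hW.2⟩
  · have e1 : idemZ k Y X * Y (Sum.inr (Sum.inr i)) = Y (Sum.inr (Sum.inr i)) :=
      (h.isSplit_z hk).mul_y (Sum.inl i)
    have e2 : X (Sum.inr (Sum.inr i)) * idemZ k Y X = X (Sum.inr (Sum.inr i)) :=
      (h.isSplit_z hk).x_mul (Sum.inl i)
    exact ⟨e1 ▸ hF.mul_mem hZ.1 (hz (Sum.inl i)).1, e2 ▸ hF.mul_mem (hz (Sum.inl i)).2 hZ.2⟩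

end IsLeavittFamily

end Caterpillar

section Monomials

variable {K : Type} [Field K] {n : ℕ}

theorem lx_mul_ly (i j : Fin n) : lx K n i * ly K n j = if i = j then 1 else 0 := by
  have h := RingQuot.mkAlgHom_rel K (LeavittRel.xy (K := K) i j)
  rw [map_mul] at h
  rw [lx, ly, h]
  split_ifs <;> simp

theorem sum_ly_mul_lx : ∑ i, ly K n i * lx K n i = 1 := by
  have h := RingQuot.mkAlgHom_rel K (LeavittRel.yx (K := K) (n := n))
  simpa [lx, ly] using h

@[simp]
theorem yW_nil : yW K n [] = 1 := rfl

@[simp]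
theorem xW_nil : xW K n [] = 1 := rfl

theorem yW_cons (i : Fin n) (I : List (Fin n)) : yW K n (i :: I) = ly K n i * yW K n I := by
  simp [yW]

theorem yW_append (I J : List (Fin n)) : yW K n (I ++ J) = yW K n I * yW K n J := by
  simp [yW]

theorem xW_cons (i : Fin n) (I : List (Fin n)) : xW K n (i :: I) = xW K n I * lx K n i := by
  simp [xW]

theorem xW_append (I J : List (Fin n)) : xW K n (I ++ J) = xW K n J * xW K n I := by
  simp [xW]

theorem xW_mul_yW (I : List (Fin n)) : xW K n I * yW K n I = 1 := by
  induction I with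
  | nil => simp
  | cons i I ih =>
    rw [xW_cons, yW_cons, mul_assoc, ← mul_assoc (lx K n i), lx_mul_ly]
    simpa using ih

theorem xW_mul_yW_eq_zero {I J : List (Fin n)} (h : ¬ I <+: J) (h' : ¬ J <+: I) :
    xW K n I * yW K n J = 0 := by
  induction I generalizing J with
  | nil => simp at h
  | cons i I ih =>
    cases J with
    | nil => simp at h'
    | cons j J =>
      rw [xW_cons, yW_cons, mul_assoc, ← mul_assoc (lx K n i), lx_mul_ly]
      by_cases hij : i = j
      · subst hij
        rw [List.prefix_cons_inj] at h h'
        simpa using ih h h'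
      · simp [hij]

theorem isSumYX_iff (a : Leavitt K n) : IsSumYX K n a ↔
    a ∈ AddSubmonoid.closure
      (Set.range fun p : List (Fin n) × List (Fin n) => yW K n p.1 * xW K n p.2) := by
  constructor
  · rintro ⟨m, I, J, rfl⟩
    exact sum_mem fun i _ => AddSubmonoid.subset_closure ⟨(I i, J i), rfl⟩
  · intro h
    induction h using AddSubmonoid.closure_induction with
    | mem x hx =>
      obtain ⟨p, rfl⟩ := hx
      exact ⟨1, fun _ => p.1, fun _ => p.2, by simp⟩
    | zero => exact ⟨0, fun _ => [], fun _ => [], by simp⟩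
    | add x y _ _ hx hy =>
      obtain ⟨m, I, J, rfl⟩ := hx
      obtain ⟨m', I', J', rfl⟩ := hy
      exact ⟨m + m', Fin.append I I', Fin.append J J', by simp [Fin.sum_univ_add]⟩

theorem isSumYX_monomial (I J : List (Fin n)) : IsSumYX K n (yW K n I * xW K n J) :=
  (isSumYX_iff _).2 (AddSubmonoid.subset_closure ⟨(I, J), rfl⟩)

namespace IsSumYX

theorem zero : IsSumYX K n 0 := (isSumYX_iff _).2 (zero_mem _)

theorem one : IsSumYX K n 1 := by simpa using isSumYX_monomial (K := K) (n := n) [] []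

theorem ly (i : Fin n) : IsSumYX K n (ly K n i) := by
  simpa [yW_cons] using isSumYX_monomial (K := K) [i] []

theorem lx (i : Fin n) : IsSumYX K n (lx K n i) := by
  simpa [xW_cons] using isSumYX_monomial (K := K) [] [i]

theorem add {a b : Leavitt K n} (ha : IsSumYX K n a) (hb : IsSumYX K n b) :
    IsSumYX K n (a + b) := by
  rw [isSumYX_iff] at *
  exact add_mem ha hb

theorem ly_mul {a : Leavitt K n} (ha : IsSumYX K n a) (i : Fin n) :
    IsSumYX K n (_root_.ly K n i * a) := by
  rw [isSumYX_iff] at ha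
  induction ha using AddSubmonoid.closure_induction with
  | mem x hx =>
    obtain ⟨p, rfl⟩ := hx
    simpa [yW_cons, mul_assoc] using isSumYX_monomial (K := K) (i :: p.1) p.2
  | zero => simpa using zero
  | add x y _ _ hx hy => simpa [mul_add] using hx.add hy

theorem lx_mul {a : Leavitt K n} (ha : IsSumYX K n a) (i : Fin n) :
    IsSumYX K n (_root_.lx K n i * a) := by
  rw [isSumYX_iff] at ha
  induction ha using AddSubmonoid.closure_induction with
  | mem x hx =>
    obtain ⟨⟨_ | ⟨j, I⟩, J⟩, rfl⟩ := hx
    · simpa [xW_append, xW_cons] using isSumYX_monomial (K := K) [] (J ++ [i])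
    · simp only [yW_cons, ← mul_assoc, lx_mul_ly]
      split_ifs
      · simpa using isSumYX_monomial I J
      · simpa using zero
  | zero => simpa using zero
  | add x y _ _ hx hy => simpa [mul_add] using hx.add hy

theorem mul {a b : Leavitt K n} (ha : IsSumYX K n a) (hb : IsSumYX K n b) :
    IsSumYX K n (a * b) := by
  have hy : ∀ I {c : Leavitt K n}, IsSumYX K n c → IsSumYX K n (yW K n I * c) := by
    intro I c hc
    induction I with
    | nil => simpa using hc
    | cons i I ih => simpa [yW_cons, mul_assoc] using ih.ly_mul i
  have hx : ∀ J {c : Leavitt K n}, IsSumYX K n c → IsSumYX K n (xW K n J * c) := by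
    intro J
    induction J with
    | nil => intro c hc; simpa using hc
    | cons i J ih => intro c hc; simpa [xW_cons, mul_assoc] using ih (hc.lx_mul i)
  rw [isSumYX_iff] at ha
  induction ha using AddSubmonoid.closure_induction with
  | mem x hx' =>
    obtain ⟨p, rfl⟩ := hx'
    simpa [mul_assoc] using hy p.1 (hx p.2 hb)
  | zero => simpa using zero
  | add x y _ _ hx hy => simpa [add_mul] using hx.add hy

theorem pow {a : Leavitt K n} (ha : IsSumYX K n a) (k : ℕ) : IsSumYX K n (a ^ k) := by
  induction k with
  | zero => simpa using one
  | succ k ih => simpa [pow_succ] using ih.mul ha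

theorem sum {ι : Type} {s : Finset ι} {a : ι → Leavitt K n} (ha : ∀ i ∈ s, IsSumYX K n (a i)) :
    IsSumYX K n (∑ i ∈ s, a i) := by
  simp only [isSumYX_iff] at *
  exact sum_mem ha

end IsSumYX

end Monomials

section Simplicity

variable {K : Type} [Field K] {n : ℕ}

/-- Multiplying by a long enough `y_J` turns every element into a combination of words `y_I`. -/
theorem exists_forall_mul_yW_mem_span (a : Leavitt K n) :
    ∃ N, ∀ J : List (Fin n), N ≤ J.length →
      a * yW K n J ∈ Submodule.span K (Set.range (yW K n)) := by
  obtain ⟨a, rfl⟩ := RingQuot.mkAlgHom_surjective K (LeavittRel K n) a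
  induction a using FreeAlgebra.induction with
  | grade0 r =>
    refine ⟨0, fun J _ => ?_⟩
    rw [AlgHom.commutes, ← Algebra.smul_def]
    exact Submodule.smul_mem _ _ (Submodule.subset_span ⟨J, rfl⟩)
  | grade1 i =>
    rcases i with i | i
    · refine ⟨1, fun J hJ => ?_⟩
      obtain _ | ⟨j, J⟩ := J
      · simp at hJ
      · have : RingQuot.mkAlgHom K (LeavittRel K n) (FreeAlgebra.ι K (Sum.inl i)) = lx K n i := rfl
        rw [this, yW_cons, ← mul_assoc, lx_mul_ly]
        split_ifs
        · simpa using Submodule.subset_span (Set.mem_range_self J)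
        · simp
    · exact ⟨0, fun J _ => Submodule.subset_span ⟨i :: J, yW_cons i J⟩⟩
  | add a b ha hb =>
    obtain ⟨N, hN⟩ := ha
    obtain ⟨M, hM⟩ := hb
    refine ⟨max N M, fun J hJ => ?_⟩
    rw [map_add, add_mul]
    exact add_mem (hN J (by omega)) (hM J (by omega))
  | mul a b ha hb =>
    obtain ⟨N, hN⟩ := ha
    obtain ⟨M, hM⟩ := hb
    refine ⟨M + N, fun J hJ => ?_⟩
    rw [← List.take_append_drop M J, yW_append, map_mul, mul_assoc, ← mul_assoc _ (yW K n _)]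
    have h := hM (J.take M) (by simp; omega)
    generalize RingQuot.mkAlgHom K (LeavittRel K n) b * yW K n (J.take M) = c at h ⊢
    induction h using Submodule.span_induction with
    | mem x hx =>
      obtain ⟨I, rfl⟩ := hx
      rw [← yW_append]
      exact hN _ (by simp; omega)
    | zero => simp
    | add x y _ _ hx hy =>
      rw [add_mul, mul_add]
      exact add_mem hx hy
    | smul r x _ hx =>
      rw [smul_mul_assoc, mul_smul_comm]
      exact Submodule.smul_mem _ _ hx

theorem exists_mul_yW_ne_zero {a : Leavitt K n} (ha : a ≠ 0) (N : ℕ) :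
    ∃ J : List (Fin n), J.length = N ∧ a * yW K n J ≠ 0 := by
  induction N with
  | zero => exact ⟨[], rfl, by simpa using ha⟩
  | succ N ih =>
    obtain ⟨J, hJ, h⟩ := ih
    by_contra! hcon
    refine h ?_
    rw [← mul_one (a * _), ← sum_ly_mul_lx, Finset.mul_sum]
    refine Finset.sum_eq_zero fun i _ => ?_
    have := hcon (J ++ [i]) (by simp [hJ])
    rw [yW_append, yW_cons, yW_nil, mul_one, ← mul_assoc] at this
    rw [← mul_assoc, this, zero_mul]

/-- A nonzero element of a Leavitt algebra generates it as an ideal. -/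
theorem exists_mul_mul_eq_one (hn : 2 ≤ n) {a : Leavitt K n} (ha : a ≠ 0) :
    ∃ u v, u * a * v = 1 := by
  obtain ⟨N, hN⟩ := exists_forall_mul_yW_mem_span a
  obtain ⟨J, hJ, hne⟩ := exists_mul_yW_ne_zero ha N
  obtain ⟨c, hc⟩ := Finsupp.mem_span_range_iff_exists_finsupp.1 (hN J hJ.ge)
  have hc0 : c.support.Nonempty := by
    rw [Finsupp.support_nonempty_iff]
    rintro rfl
    exact hne (by simpa using hc.symm)
  obtain ⟨I₀, hI₀, hmin⟩ := c.support.exists_min_image List.length hc0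
  set M := c.support.sup List.length with hM
  set w : List (Fin n) := List.replicate M ⟨0, by omega⟩ ++ [⟨1, by omega⟩] with hw
  have hlen : ∀ I ∈ c.support, I.length ≤ M := fun I hI => Finset.le_sup hI
  have key : ∀ I ∈ c.support, I ≠ I₀ → xW K n (I₀ ++ w) * (yW K n I * yW K n w) = 0 := by
    intro I hI hne
    rw [← yW_append]
    by_cases hp : I₀ <+: I
    · obtain ⟨I', rfl⟩ := hp
      have hI' : I' ≠ [] := by rintro rfl; simp at hne
      have hl := hlen _ hI
      rw [List.length_append] at hl
      rw [xW_append, List.append_assoc, yW_append, mul_assoc, ← mul_assoc (xW K n I₀), xW_mul_yW,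
        one_mul]
      have h1 : ¬ w <+: I' ++ w := by
        intro h
        have h3 := List.length_pos_iff.2 hI'
        have h2 := h.getElem (i := M) (by simp [hw])
        rw [List.getElem_append_right (as := I') (bs := w) (by omega)] at h2
        simp only [hw] at h2
        rw [List.getElem_append_left (bs := [(⟨1, by omega⟩ : Fin n)]) (i := M - I'.length)
          (by simp; omega)] at h2
        simp at h2
      exact xW_mul_yW_eq_zero h1 fun h => by
        have := h.length_le
        have h3 := List.length_pos_iff.2 hI'
        rw [List.length_append] at this
        omega
    · have h1 : ¬ I <+: I₀ := fun h => hp (h.eq_of_length_le (hmin I hI) ▸ List.prefix_rfl)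
      rw [xW_append, yW_append, mul_assoc, ← mul_assoc (xW K n I₀), xW_mul_yW_eq_zero hp h1]
      simp
  have hcI : c I₀ ≠ 0 := Finsupp.mem_support_iff.1 hI₀
  refine ⟨xW K n (I₀ ++ w), (c I₀)⁻¹ • (yW K n J * yW K n w), ?_⟩
  rw [mul_smul_comm, mul_assoc, ← mul_assoc a, ← hc, Finsupp.sum, Finset.sum_mul, Finset.mul_sum,
    Finset.sum_eq_single_of_mem I₀ hI₀]
  · rw [smul_mul_assoc, mul_smul_comm, ← yW_append, xW_mul_yW, smul_smul, inv_mul_cancel₀ hcI,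
      one_smul]
  · intro I hI hne
    rw [smul_mul_assoc, mul_smul_comm, key I hI hne, smul_zero]

end Simplicity

section Corner

theorem Row.exists_monochromatic {R : Type} [Ring R] {E : Fin 3 → R} {p : Fin 3} {l : ℕ}
    (S : Row E p ![0, 0, l]) :
    ∃ y x : Fin l → R, IsSplit E p (fun _ => 2) y x ∧
      ∀ F, S.Mem F ↔ SplitMem F p (fun _ => 2) y x := by
  let g : Fin l → Σ q : Fin 3, Fin (![0, 0, l] q) := fun i => ⟨2, i⟩
  have hg : Function.Bijective g := by
    refine ⟨fun i j hij => eq_of_heq (Sigma.mk.inj_iff.1 hij).2, ?_⟩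
    rintro ⟨q, i⟩
    fin_cases q
    · exact i.elim0
    · exact i.elim0
    · exact ⟨i, rfl⟩
  let e := Equiv.ofBijective g hg
  exact ⟨S.y ∘ e, S.x ∘ e, S.isSplit.reindex e, fun F => (splitMem_reindex e).symm⟩

theorem IsLeavittFamily.exists_monochromatic {R : Type} [Ring R] {t m : ℕ}
    {Y X : Unit ⊕ Fin t ⊕ Fin m → R} (h : IsLeavittFamily Y X) {N k k' : ℕ} (hN : 0 < N)
    (hm : m + t = N) (hk : k * t = 1 + N * k') :
    ∃ f : Fin 3 → ℕ, f 2 = 1 + N ∧ ∃ y x : (p : Fin 3) → Fin (f p) → R,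
      (∀ p, IsSplit (idems k Y X) p (fun _ => 2) (y p) (x p)) ∧
      ∀ F, IsHomFamily (idems k Y X) F →
        ((∀ p, SplitMem F p (fun _ => 2) (y p) (x p)) ↔ RowsMem k Y X F) := by
  have hk0 : 0 < k := by
    rcases Nat.eq_zero_or_pos k with rfl | hk0
    · omega
    · exact hk0
  obtain ⟨a, b, c, habc⟩ := Reach.eliminate hN hm hk (h.reach hk0)
  obtain ⟨ya, xa, ha, ha'⟩ := a.exists_monochromatic
  obtain ⟨yb, xb, hb, hb'⟩ := b.exists_monochromatic
  obtain ⟨yc, xc, hc, hc'⟩ := c.exists_monochromatic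
  refine ⟨![k + N, N, 1 + N], rfl, fun p => match p with | 0 => ya | 1 => yb | 2 => yc,
    fun p => match p with | 0 => xa | 1 => xb | 2 => xc, ?_, fun F hF => ?_⟩
  · intro p
    fin_cases p
    exacts [ha, hb, hc]
  · rw [← habc F hF, ha', hb', hc', Fin.forall_fin_succ, Fin.forall_fin_succ,
      Fin.forall_fin_succ]
    simp only [IsEmpty.forall_iff, and_true]
    rfl

variable {R : Type} [Ring R] {t : ℕ}

/-- The matrix of an element with respect to the coordinates `y`, `x` of a summand. -/
def corner (y x : Fin t → R) : R →+ Matrix (Fin t) (Fin t) R where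
  toFun a := Matrix.of fun i j => x i * a * y j
  map_zero' := by ext; simp
  map_add' a b := by ext; simp [mul_add, add_mul]

theorem corner_apply (y x : Fin t → R) (a : R) (i j : Fin t) :
    corner y x a i j = x i * a * y j := rfl

theorem corner_mul {y x : Fin t → R} {a b : R} (ha : a * ∑ i, y i * x i = a) :
    corner y x (a * b) = corner y x a * corner y x b := by
  ext i j
  rw [Matrix.mul_apply]
  conv_lhs => rw [corner_apply, ← ha]
  simp [Finset.mul_sum, Finset.sum_mul, corner_apply, mul_assoc]

theorem corner_sum {y x : Fin t → R} (h : ∀ i j, x i * y j = if i = j then 1 else 0) :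
    corner y x (∑ i, y i * x i) = 1 := by
  ext i j
  simp [corner_apply, Finset.mul_sum, Finset.sum_mul, mul_assoc, h, Matrix.one_apply]

theorem corner_sum_mul_mul {y x : Fin t → R} (h : ∀ i j, x i * y j = if i = j then 1 else 0)
    (M : Matrix (Fin t) (Fin t) R) :
    corner y x (∑ i, ∑ j, y i * M i j * x j) = M := by
  ext i j
  simp only [corner_apply, Finset.mul_sum, Finset.sum_mul]
  have : ∀ p q, x i * (y p * M p q * x q) * y j = (x i * y p) * M p q * (x q * y j) := by
    intro p q; noncomm_ring
  simp [this, h]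

variable {K : Type} [Field K] [Algebra K R]

theorem corner_smul (y x : Fin t → R) (r : K) (a : R) :
    corner y x (r • a) = r • corner y x a := by
  ext i j
  simp [corner_apply]

/-- The matrices of the summands of the monochromatic rows generate the matrix algebra. -/
theorem IsLeavittFamily.eq_top_of_corner_mem {m k : ℕ} (hk : 0 < k)
    {Y X : Unit ⊕ Fin t ⊕ Fin m → R} (h : IsLeavittFamily Y X)
    (hgen : Algebra.adjoin K (Set.range Y ∪ Set.range X) = ⊤)
    {f : Fin 3 → ℕ} {y x : (p : Fin 3) → Fin (f p) → R}
    (hsplit : ∀ p, IsSplit (idems k Y X) p (fun _ => 2) (y p) (x p))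
    (hrows : ∀ F, IsHomFamily (idems k Y X) F →
      (∀ p, SplitMem F p (fun _ => 2) (y p) (x p)) → RowsMem k Y X F)
    (S : Subalgebra K (Matrix (Fin t) (Fin t) R))
    (hS : ∀ i, corner (fun i => Y (Sum.inr (Sum.inl i))) (fun i => X (Sum.inr (Sum.inl i)))
        (y 2 i) ∈ S ∧
      corner (fun i => Y (Sum.inr (Sum.inl i))) (fun i => X (Sum.inr (Sum.inl i))) (x 2 i) ∈ S) :
    S = ⊤ := by
  set yw : Fin t → R := fun i => Y (Sum.inr (Sum.inl i)) with hyw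
  set xw : Fin t → R := fun i => X (Sum.inr (Sum.inl i)) with hxw
  set E := idems k Y X with hE
  have hE2 : E 2 = ∑ i, yw i * xw i := rfl
  have hE0 : E 0 = 1 := rfl
  have hone : ∀ i j, xw i * yw j = if i = j then 1 else 0 := fun i j => by
    simp [hyw, hxw, h.x_mul_y]
  have hmul : ∀ {a b}, a * E 2 = a → corner yw xw (a * b) = corner yw xw a * corner yw xw b :=
    fun ha => corner_mul ha
  have hcE : corner yw xw (E 2) = 1 := corner_sum hone
  let F : Fin 3 → Fin 3 → Set R := fun p q =>
    {a | a * E q = a ∧ ∀ i j, corner yw xw (x p i * a * y q j) ∈ S}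
  have hF : IsHomFamily E F :=
    { zero_mem := fun p q => ⟨by simp, fun i j => by simp⟩
      add_mem := fun {p q a b} ha hb => ⟨by rw [add_mul, ha.1, hb.1], fun i j => by
        rw [mul_add, add_mul, map_add]
        exact add_mem (ha.2 i j) (hb.2 i j)⟩
      mul_mem := fun {p q r a b} ha hb => ⟨by rw [mul_assoc, hb.1], fun i j => by
        have : x p i * (a * b) * y r j =
            ∑ l, (x p i * a * y q l) * (x q l * b * y r j) := by
          have e : ∀ l, (x p i * a * y q l) * (x q l * b * y r j) =
            x p i * a * (y q l * x q l) * (b * y r j) := fun l => by noncomm_ring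
          simp only [e]
          rw [← Finset.sum_mul, ← Finset.mul_sum, (hsplit q).sum_eq, mul_assoc (x p i) a, ha.1]
          noncomm_ring
        rw [this, map_sum]
        refine sum_mem fun l _ => ?_
        rw [hmul (by rw [mul_assoc, (hsplit q).y_mul])]
        exact mul_mem (ha.2 i l) (hb.2 l j)⟩
      one_mem := fun p => ⟨(hsplit p).idem, fun i j => by
        rw [mul_assoc, (hsplit p).mul_y, (hsplit p).x_mul_y]
        split_ifs
        · rw [hcE]; exact one_mem S
        · rw [map_zero]; exact zero_mem S⟩ }
  have hyx : ∀ p, SplitMem F p (fun _ => 2) (y p) (x p) := fun p l =>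
    ⟨⟨(hsplit p).y_mul l, fun i j => by
      rw [(hsplit p).x_mul_y]
      split_ifs
      · rw [(hsplit 2).mul_y]; exact (hS j).1
      · simp⟩,
    ⟨(hsplit p).x_mul l, fun i j => by
      rw [mul_assoc, (hsplit p).x_mul_y]
      split_ifs
      · rw [(hsplit 2).x_mul]; exact (hS i).2
      · simp⟩⟩
  obtain ⟨⟨hW, hW'⟩, hYX⟩ := h.mem_of_rowsMem hk hF (hrows F hF hyx)
  have hall : ∀ a, a ∈ F 0 0 := by
    intro a
    have ha : a ∈ Algebra.adjoin K (Set.range Y ∪ Set.range X) := by rw [hgen]; trivial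
    induction ha using Algebra.adjoin_induction with
    | mem a ha =>
      rcases ha with ⟨i, rfl⟩ | ⟨i, rfl⟩
      exacts [(hYX i).1, (hYX i).2]
    | algebraMap r =>
      refine ⟨by rw [hE0, mul_one], fun i j => ?_⟩
      have := (hF.one_mem 0).2 i j
      rw [hE0] at this
      rw [Algebra.algebraMap_eq_smul_one, mul_smul_comm, smul_mul_assoc, corner_smul]
      exact S.smul_mem this r
    | add a b _ _ ha hb => exact hF.add_mem ha hb
    | mul a b _ _ ha hb => exact hF.mul_mem ha hb
  rw [eq_top_iff]
  rintro M -
  set a := ∑ i, ∑ j, yw i * M i j * xw j with ha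
  rw [← corner_sum_mul_mul hone M, ← ha]
  have ha1 : idemW Y X * a = a := by
    simp only [ha, Finset.mul_sum, ← mul_assoc, hyw, h.idemW_mul_y]
  have ha2 : a * idemW Y X = a := by
    simp only [ha, Finset.sum_mul, mul_assoc, hxw, h.x_mul_idemW]
  have ha22 : a ∈ F 2 2 := by
    have := hF.mul_mem (hF.mul_mem hW' (hall a)) hW
    rwa [ha1, ha2] at this
  have hsum : a = ∑ i, ∑ j, y 2 i * (x 2 i * a * y 2 j * x 2 j) := by
    have e : ∀ i j, y 2 i * (x 2 i * a * y 2 j * x 2 j) =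
      (y 2 i * x 2 i) * a * (y 2 j * x 2 j) := fun i j => by noncomm_ring
    simp only [e, ← Finset.mul_sum, ← Finset.sum_mul, (hsplit 2).sum_eq]
    change a = idemW Y X * a * idemW Y X
    rw [ha1, ha2]
  rw [hsum]
  simp only [map_sum]
  refine sum_mem fun i _ => sum_mem fun j _ => ?_
  rw [hmul ((hsplit 2).y_mul i), hmul (by rw [mul_assoc, (hsplit 2).y_mul])]
  exact mul_mem (hS i).1 (mul_mem (ha22.2 i j) (hS j).2)

end Corner

section MatrixIso

variable {K : Type} [Field K] {n : ℕ}

theorem Leavitt.exists_lift {A : Type} [Ring A] [Algebra K A] (u v : Fin n → A)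
    (huv : ∀ i j, u i * v j = if i = j then 1 else 0) (hvu : ∑ i, v i * u i = 1) :
    ∃ φ : Leavitt K n →ₐ[K] A, (∀ i, φ (lx K n i) = u i) ∧ ∀ i, φ (ly K n i) = v i := by
  refine ⟨RingQuot.liftAlgHom K ⟨FreeAlgebra.lift K (Sum.elim u v), ?_⟩, ?_, ?_⟩
  · intro a b h
    induction h with
    | xy i j =>
      rw [map_mul, FreeAlgebra.lift_ι_apply, FreeAlgebra.lift_ι_apply]
      simp only [Sum.elim_inl, Sum.elim_inr, huv]
      split_ifs <;> simp
    | yx => simpa using hvu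
  · intro i
    rw [lx, RingQuot.liftAlgHom_mkAlgHom_apply, FreeAlgebra.lift_ι_apply, Sum.elim_inl]
  · intro i
    rw [ly, RingQuot.liftAlgHom_mkAlgHom_apply, FreeAlgebra.lift_ι_apply, Sum.elim_inr]

theorem Leavitt.adjoin_range_eq_top :
    Algebra.adjoin K (Set.range (ly K n) ∪ Set.range (lx K n)) = ⊤ := by
  have h := congrArg (Subalgebra.map (RingQuot.mkAlgHom K (LeavittRel K n)))
    (FreeAlgebra.adjoin_range_ι (R := K) (X := Fin n ⊕ Fin n))
  rw [AlgHom.map_adjoin, ← Set.range_comp, Algebra.map_top,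
    (AlgHom.range_eq_top _).2 (RingQuot.mkAlgHom_surjective K _)] at h
  rw [← h, Set.union_comm]
  congr 1
  ext a
  simp [lx, ly]

theorem Leavitt.isLeavittFamily {t m : ℕ} (σ : Unit ⊕ Fin t ⊕ Fin m ≃ Fin n) :
    IsLeavittFamily (ly K n ∘ σ) (lx K n ∘ σ) where
  x_mul_y i j := by simp [lx_mul_ly]
  sum_eq := by
    rw [← sum_ly_mul_lx]
    exact σ.sum_comp fun i => ly K n i * lx K n i

theorem IsSumYX.matrix_mul {α β γ : Type} [Fintype β] {A : Matrix α β (Leavitt K n)}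
    {B : Matrix β γ (Leavitt K n)} (hA : ∀ i j, IsSumYX K n (A i j))
    (hB : ∀ i j, IsSumYX K n (B i j)) (i : α) (j : γ) : IsSumYX K n ((A * B) i j) := by
  rw [Matrix.mul_apply]
  exact IsSumYX.sum fun l _ => (hA i l).mul (hB l j)

theorem IsSumYX.matrix_one {α : Type} [DecidableEq α] (i j : α) :
    IsSumYX K n ((1 : Matrix α α (Leavitt K n)) i j) := by
  rw [Matrix.one_apply]
  split_ifs
  exacts [one, zero]

/-- A homomorphism to matrices preserves sums of monomials if it does so on generators. -/
theorem IsSumYX.map {t : ℕ} (φ : Leavitt K n →ₐ[K] Matrix (Fin t) (Fin t) (Leavitt K n))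
    (hx : ∀ l i j, IsSumYX K n (φ (_root_.lx K n l) i j))
    (hy : ∀ l i j, IsSumYX K n (φ (_root_.ly K n l) i j))
    {a : Leavitt K n} (ha : IsSumYX K n a) (i j : Fin t) : IsSumYX K n (φ a i j) := by
  have hyW : ∀ I i j, IsSumYX K n (φ (yW K n I) i j) := by
    intro I
    induction I with
    | nil => simpa using matrix_one
    | cons l I ih => rw [yW_cons, map_mul]; exact matrix_mul (hy l) ih
  have hxW : ∀ I i j, IsSumYX K n (φ (xW K n I) i j) := by
    intro I
    induction I with
    | nil => simpa using matrix_one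
    | cons l I ih => rw [xW_cons, map_mul]; exact matrix_mul ih (hx l)
  obtain ⟨m, I, J, rfl⟩ := ha
  rw [map_sum, Matrix.sum_apply]
  refine sum fun l _ => ?_
  rw [map_mul]
  exact matrix_mul (hyW _) (hxW _) i j

theorem rowsMem_isSumYX {t m : ℕ} {Y X : Unit ⊕ Fin t ⊕ Fin m → Leavitt K n}
    (hY : ∀ i, IsSumYX K n (Y i)) (hX : ∀ i, IsSumYX K n (X i)) (k : ℕ) :
    IsHomFamily (idems k Y X) (fun _ _ => {a | IsSumYX K n a}) ∧
      IsLeavittFamily.RowsMem k Y X fun _ _ => {a | IsSumYX K n a} := by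
  have hW : IsSumYX K n (idemW Y X) := .sum fun i _ => (hY _).mul (hX _)
  have hM : IsSumYX K n (idemM Y X) := .sum fun i _ => (hY _).mul (hX _)
  have hZ : IsSumYX K n (idemZ k Y X) :=
    .add (.sum fun j _ => (((hY _).pow j).mul hM).mul ((hX _).pow j))
      (((hY _).pow k).mul ((hX _).pow k))
  refine ⟨⟨fun _ _ => .zero, .add, .mul, fun p => ?_⟩, ?_, ?_, fun i => ⟨hY _, hX _⟩⟩
  · fin_cases p
    exacts [.one, hZ, hW]
  · rintro (i | i)
    exacts [⟨hZ, hZ⟩, ⟨((hY _).pow _).mul hW, hW.mul ((hX _).pow _)⟩]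
  · rintro (i | i | i)
    exacts [⟨hY _, hX _⟩, ⟨(hY _).mul hZ, hZ.mul (hX _)⟩,
      ⟨((hY _).pow _).mul hW, hW.mul ((hX _).pow _)⟩]

theorem Leavitt.exists_algEquiv_matrix (hn : 2 ≤ n) {t k k' : ℕ} (ht : 0 < t) (htn : t ≤ n - 1)
    (hk : k * t = 1 + (n - 1) * k') :
    ∃ e : Leavitt K n ≃ₐ[K] Matrix (Fin t) (Fin t) (Leavitt K n),
      ∀ a, IsSumYX K n a → ∀ i j, IsSumYX K n (e a i j) := by
  have hk0 : 0 < k := by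
    rcases Nat.eq_zero_or_pos k with rfl | hk0
    · omega
    · exact hk0
  let σ : Unit ⊕ Fin t ⊕ Fin (n - 1 - t) ≃ Fin n :=
    Fintype.equivOfCardEq (by simp; omega)
  have h := Leavitt.isLeavittFamily (K := K) σ
  have hgen : Algebra.adjoin K (Set.range (ly K n ∘ σ) ∪ Set.range (lx K n ∘ σ)) = ⊤ := by
    rw [σ.surjective.range_comp, σ.surjective.range_comp, adjoin_range_eq_top]
  obtain ⟨f, hf, y, x, hsplit, hrows⟩ :=
    h.exists_monochromatic (N := n - 1) (by omega) (by omega) hk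
  set Y := ly K n ∘ σ with hY
  set X := lx K n ∘ σ with hX
  let c : Fin n ≃ Fin (f 2) := finCongr (by omega)
  let π := corner (fun i => Y (Sum.inr (Sum.inl i))) (fun i => X (Sum.inr (Sum.inl i)))
  have hπE : π (idems k Y X 2) = 1 := corner_sum fun i j => by simp [h.x_mul_y]
  have hπ : ∀ {a b}, a * idems k Y X 2 = a → π (a * b) = π a * π b := fun ha => corner_mul ha
  obtain ⟨φ, hφx, hφy⟩ := Leavitt.exists_lift (K := K) (fun i => π (x 2 (c i)))
    (fun i => π (y 2 (c i)))
    (fun i j => by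
      rw [← hπ ((hsplit 2).x_mul _), (hsplit 2).x_mul_y]
      simp only [c.injective.eq_iff]
      split_ifs
      exacts [hπE, map_zero π])
    (by
      simp only [← hπ ((hsplit 2).y_mul _)]
      rw [c.sum_comp fun i => π (y 2 i * x 2 i), ← map_sum, (hsplit 2).sum_eq, hπE])
  have hinj : Function.Injective φ := by
    rw [injective_iff_map_eq_zero]
    intro a ha
    by_contra ha0
    obtain ⟨u, v, huv⟩ := exists_mul_mul_eq_one hn ha0
    have h1 := congrArg φ huv
    rw [map_mul, map_mul, ha, mul_zero, zero_mul, map_one] at h1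
    have h2 := congrFun (congrFun h1 ⟨0, ht⟩) ⟨0, ht⟩
    rw [Matrix.zero_apply, Matrix.one_apply_eq] at h2
    exact ha0 (by rw [← mul_one a, ← h2, mul_zero])
  have hsurj : Function.Surjective φ := by
    rw [← AlgHom.range_eq_top]
    refine h.eq_top_of_corner_mem hk0 hgen hsplit (fun F hF => (hrows F hF).1) _ fun i => ?_
    obtain ⟨i, rfl⟩ := c.surjective i
    exact ⟨⟨ly K n i, hφy i⟩, ⟨lx K n i, hφx i⟩⟩
  obtain ⟨hF, hR⟩ := rowsMem_isSumYX (K := K) (Y := Y) (X := X) (fun i => .ly _) (fun i => .lx _) k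
  have hyx := (hrows _ hF).2 hR 2
  refine ⟨AlgEquiv.ofBijective φ ⟨hinj, hsurj⟩, fun a ha => IsSumYX.map φ ?_ ?_ ha⟩
  · intro l i j
    rw [hφx]
    exact ((IsSumYX.lx _).mul (hyx _).2).mul (.ly _)
  · intro l i j
    rw [hφy]
    exact ((IsSumYX.lx _).mul (hyx _).1).mul (.ly _)

end MatrixIso

section FreeModules

/-- The free modules on `α` and `β` are isomorphic via matrices of sums of monomials. -/
def MonomialIso (K : Type) [Field K] (n : ℕ) (α β : Type) [Fintype α] [DecidableEq α]
    [Fintype β] [DecidableEq β] : Prop :=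
  ∃ (P : Matrix α β (Leavitt K n)) (Q : Matrix β α (Leavitt K n)), P * Q = 1 ∧ Q * P = 1 ∧
    (∀ i j, IsSumYX K n (P i j)) ∧ ∀ i j, IsSumYX K n (Q i j)

variable {K : Type} [Field K] {n : ℕ} {α β γ : Type} [Fintype α] [DecidableEq α]
  [Fintype β] [DecidableEq β] [Fintype γ] [DecidableEq γ]

namespace MonomialIso

theorem of_equiv (e : α ≃ β) : MonomialIso K n α β :=
  ⟨(1 : Matrix β β _).submatrix e id, (1 : Matrix β β _).submatrix id e,
    (Matrix.submatrix_mul_equiv _ _ e (Equiv.refl β) e).trans (by simp),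
    by rw [Matrix.submatrix_mul_equiv _ _ id e id]; simp,
    fun _ _ => .matrix_one _ _, fun _ _ => .matrix_one _ _⟩

theorem symm (h : MonomialIso K n α β) : MonomialIso K n β α := by
  obtain ⟨P, Q, h1, h2, hP, hQ⟩ := h
  exact ⟨Q, P, h2, h1, hQ, hP⟩

theorem trans (h : MonomialIso K n α β) (h' : MonomialIso K n β γ) : MonomialIso K n α γ := by
  obtain ⟨P, Q, h1, h2, hP, hQ⟩ := h
  obtain ⟨P', Q', h1', h2', hP', hQ'⟩ := h'
  refine ⟨P * P', Q' * Q, ?_, ?_, IsSumYX.matrix_mul hP hP', IsSumYX.matrix_mul hQ' hQ⟩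
  · rw [Matrix.mul_assoc, ← Matrix.mul_assoc P', h1', Matrix.one_mul, h1]
  · rw [Matrix.mul_assoc, ← Matrix.mul_assoc Q, h2, Matrix.one_mul, h2']

theorem expand (α : Type) [Fintype α] [DecidableEq α] :
    MonomialIso K n (α ⊕ Unit) (α ⊕ Fin n) := by
  refine ⟨Matrix.fromBlocks 1 0 0 (Matrix.of fun _ j => ly K n j),
    Matrix.fromBlocks 1 0 0 (Matrix.of fun i _ => lx K n i), ?_, ?_, ?_, ?_⟩
  · rw [Matrix.fromBlocks_multiply, ← Matrix.fromBlocks_one]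
    congr 1 <;> ext i j <;> simp [Matrix.mul_apply, sum_ly_mul_lx]
  · rw [Matrix.fromBlocks_multiply, ← Matrix.fromBlocks_one]
    congr 1 <;> ext i j <;> simp [Matrix.mul_apply, lx_mul_ly, Matrix.one_apply]
  · rintro (i | i) (j | j)
    exacts [.matrix_one i j, .zero, .zero, .ly j]
  · rintro (i | i) (j | j)
    exacts [.matrix_one i j, .zero, .zero, .lx i]

theorem fin_add (hn : 1 ≤ n) {a : ℕ} (ha : 1 ≤ a) (l : ℕ) :
    MonomialIso K n (Fin a) (Fin (a + (n - 1) * l)) := by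
  induction l with
  | zero => exact of_equiv (finCongr (by simp))
  | succ l ih =>
    refine ih.trans (((of_equiv (Fintype.equivOfCardEq ?_)).trans
      (expand (Fin (a + (n - 1) * l - 1)))).trans (of_equiv (Fintype.equivOfCardEq ?_)))
    · simp; omega
    · simp [mul_add]; omega

theorem fin_of_modEq (hn : 1 ≤ n) {a b : ℕ} (ha : 1 ≤ a) (hb : 1 ≤ b)
    (h : a ≡ b [MOD n - 1]) : MonomialIso K n (Fin a) (Fin b) := by
  wlog hab : a ≤ b generalizing a b
  · exact (this hb ha h.symm (by omega)).symm
  · obtain ⟨l, hl⟩ := (Nat.modEq_iff_dvd' hab).1 h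
    obtain rfl : b = a + (n - 1) * l := by omega
    exact fin_add hn ha l

theorem exists_algEquiv (h : MonomialIso K n α β) :
    ∃ e : Matrix α α (Leavitt K n) ≃ₐ[K] Matrix β β (Leavitt K n),
      ∀ A : Matrix α α (Leavitt K n), (∀ i j, IsSumYX K n (A i j)) →
        ∀ i j, IsSumYX K n (e A i j) := by
  obtain ⟨P, Q, hPQ, hQP, hP, hQ⟩ := h
  refine ⟨AlgEquiv.ofLinearEquiv
    { toFun := fun A => Q * A * P
      invFun := fun B => P * B * Q
      map_add' := fun A B => by rw [Matrix.mul_add, Matrix.add_mul]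
      map_smul' := fun r A => by rw [Matrix.mul_smul, Matrix.smul_mul]; rfl
      left_inv := fun A => by
        change P * (Q * A * P) * Q = A
        rw [Matrix.mul_assoc, Matrix.mul_assoc, hPQ, Matrix.mul_one, ← Matrix.mul_assoc, hPQ,
          Matrix.one_mul]
      right_inv := fun B => by
        change Q * (P * B * Q) * P = B
        rw [Matrix.mul_assoc, Matrix.mul_assoc, hQP, Matrix.mul_one, ← Matrix.mul_assoc, hQP,
          Matrix.one_mul] } ?_ ?_, fun A hA => ?_⟩
  · change Q * (1 : Matrix α α (Leavitt K n)) * P = 1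
    rw [Matrix.mul_one, hQP]
  · intro A B
    change Q * (A * B) * P = Q * A * P * (Q * B * P)
    simp only [Matrix.mul_assoc]
    rw [← Matrix.mul_assoc P, hPQ, Matrix.one_mul]
  · exact IsSumYX.matrix_mul (IsSumYX.matrix_mul hQ hA) hP

end MonomialIso

end FreeModules

/-- Residues with the same greatest common divisor with the modulus differ by a unit. -/
theorem exists_unit_mul_modEq_of_gcd_eq {N r s : ℕ} (hN : 0 < N) (h : r.gcd N = s.gcd N) :
    ∃ t k k', 0 < t ∧ t ≤ N ∧ k * t = 1 + N * k' ∧ r * t ≡ s [MOD N] := by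
  have : NeZero N := ⟨hN.ne'⟩
  set d := r.gcd N with hd
  have hd0 : 0 < d := Nat.gcd_pos_of_pos_right _ hN
  obtain ⟨r', hr⟩ := Nat.gcd_dvd_left r N
  obtain ⟨N', hN'⟩ := Nat.gcd_dvd_right r N
  obtain ⟨s', hs⟩ : d ∣ s := h ▸ Nat.gcd_dvd_left s N
  rw [← hd] at hr hN'
  have hr' : r'.Coprime N' := by
    have := hd
    rw [hr, hN', Nat.gcd_mul_left] at this
    exact Nat.eq_of_mul_eq_mul_left hd0 (by rw [mul_one]; exact this.symm)
  have hs' : s'.Coprime N' := by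
    have := h
    rw [hs, hN', Nat.gcd_mul_left] at this
    exact Nat.eq_of_mul_eq_mul_left hd0 (by rw [mul_one]; exact this.symm)
  have hdvd : N' ∣ N := ⟨d, by rw [mul_comm]; exact hN'⟩
  obtain ⟨u, hu⟩ := ZMod.unitsMap_surjective hdvd
    ((ZMod.unitOfCoprime r' hr')⁻¹ * ZMod.unitOfCoprime s' hs')
  obtain ⟨t, ht0, htN, ht⟩ : ∃ t : ℕ, 0 < t ∧ t ≤ N ∧ (t : ZMod N) = u := by
    rcases Nat.eq_zero_or_pos (u : ZMod N).val with h0 | h0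
    · exact ⟨N, hN, le_rfl, by rw [ZMod.natCast_self, (ZMod.val_eq_zero _).1 h0]⟩
    · exact ⟨_, h0, (ZMod.val_lt _).le, ZMod.natCast_zmod_val _⟩
  set k := (↑u⁻¹ : ZMod N).val + N with hk
  have hkt : 1 ≤ k * t := Nat.mul_pos (by omega) ht0
  have hmod : 1 ≡ k * t [MOD N] := by
    rw [← ZMod.natCast_eq_natCast_iff]
    simp [hk, ht]
  obtain ⟨k', hk'⟩ := (Nat.modEq_iff_dvd' hkt).1 hmod
  refine ⟨t, k, k', ht0, htN, by omega, ?_⟩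
  have hrt : r' * t ≡ s' [MOD N'] := by
    rw [← ZMod.natCast_eq_natCast_iff]
    have h1 : ((t : ℕ) : ZMod N') = ZMod.castHom hdvd (ZMod N') u := by rw [← ht, map_natCast]
    have h2 := congrArg Units.val (eq_inv_mul_iff_mul_eq.1 hu)
    rw [Units.val_mul, ZMod.coe_unitOfCoprime, ZMod.coe_unitOfCoprime] at h2
    rw [Nat.cast_mul, h1]
    exact h2
  have := hrt.mul_left' d
  rwa [← mul_assoc, ← hr, ← hs, ← hN'] at this

/-- If `gcd r (n-1) = gcd s (n-1)` then there is a `K`-algebra isomorphism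
`M_r(L_n) ≅ M_s(L_n)` carrying matrices all of whose entries are finite sums of monomials
`y_I x_J` to matrices with the same property. -/
theorem leavitt_matrix_iso_of_gcd_eq_preserving (K : Type) [Field K] (n : ℕ) (hn : 2 ≤ n)
    (r s : ℕ) (hr : 1 ≤ r) (hs : 1 ≤ s)
    (hgcd : Nat.gcd r (n - 1) = Nat.gcd s (n - 1)) :
    ∃ e : Matrix (Fin r) (Fin r) (Leavitt K n) ≃ₐ[K] Matrix (Fin s) (Fin s) (Leavitt K n),
      ∀ A : Matrix (Fin r) (Fin r) (Leavitt K n),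
        (∀ i j, IsSumYX K n (A i j)) → ∀ i j, IsSumYX K n (e A i j) := by
  obtain ⟨t, k, k', ht, htn, hk, hrt⟩ :=
    exists_unit_mul_modEq_of_gcd_eq (N := n - 1) (by omega) hgcd
  obtain ⟨φ, hφ⟩ := Leavitt.exists_algEquiv_matrix (K := K) hn ht htn hk
  obtain ⟨ψ, hψ⟩ := (((MonomialIso.of_equiv finProdFinEquiv).trans
    (MonomialIso.fin_of_modEq (K := K) (by omega) (Nat.mul_pos hr ht) hs hrt))).exists_algEquiv
  refine ⟨((φ.mapMatrix (m := Fin r)).trans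
    (Matrix.compAlgEquiv (Fin r) (Fin t) (Leavitt K n) K)).trans ψ, fun A hA => hψ _ ?_⟩
  exact fun i j => hφ _ (hA i.1 j.1) i.2 j.2
end

section
/- Let K be a field and n ≥ 2, r, s ≥ 1 integers with gcd(n−1, r) = gcd(n−1, s). Then the groups P_{n,r} and P_{n,s} are isomorphic. -/
open scoped BigOperators

namespace Leavitt

section Algebra

variable {K : Type} [Field K] {n : ℕ}

theorem lx_mul_ly (i j : Fin n) : lx K n i * ly K n j = if i = j then 1 else 0 := by
  have h : (RingQuot.mkAlgHom K (LeavittRel K n))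
      (FreeAlgebra.ι K (Sum.inl i) * FreeAlgebra.ι K (Sum.inr j)) =
      (RingQuot.mkAlgHom K (LeavittRel K n)) (if i = j then 1 else 0) :=
    RingQuot.mkAlgHom_rel K (LeavittRel.xy i j)
  rw [map_mul] at h
  rw [lx, ly, h]
  split_ifs <;> simp

theorem sum_ly_mul_lx : ∑ j : Fin n, ly K n j * lx K n j = 1 := by
  have h : (RingQuot.mkAlgHom K (LeavittRel K n))
      (∑ j : Fin n, FreeAlgebra.ι K (Sum.inr j) * FreeAlgebra.ι K (Sum.inl j)) =
      (RingQuot.mkAlgHom K (LeavittRel K n)) 1 :=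
    RingQuot.mkAlgHom_rel K LeavittRel.yx
  simp only [map_sum, map_mul, map_one] at h
  exact h

theorem induction_on {p : Leavitt K n → Prop}
    (scalar : ∀ r : K, p (algebraMap K (Leavitt K n) r)) (hx : ∀ i, p (lx K n i))
    (hy : ∀ i, p (ly K n i)) (mul : ∀ a b, p a → p b → p (a * b))
    (add : ∀ a b, p a → p b → p (a + b)) (a : Leavitt K n) : p a := by
  obtain ⟨a, rfl⟩ := RingQuot.mkAlgHom_surjective K (LeavittRel K n) a
  induction a using FreeAlgebra.induction with
  | grade0 r => simpa using scalar r
  | grade1 s => exact s.casesOn hx hy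
  | mul a b ha hb => rw [map_mul]; exact mul _ _ ha hb
  | add a b ha hb => rw [map_add]; exact add _ _ ha hb

theorem lstarHom_lx (i : Fin n) : lstarHom K n (lx K n i) = MulOpposite.op (ly K n i) := by
  simp [lstarHom, lx, ly, leavittStarAux]

theorem lstarHom_ly (i : Fin n) : lstarHom K n (ly K n i) = MulOpposite.op (lx K n i) := by
  simp [lstarHom, lx, ly, leavittStarAux]

theorem lstar_mul (a b : Leavitt K n) : lstar K n (a * b) = lstar K n b * lstar K n a := by
  simp [lstar]

theorem lstar_lstar (a : Leavitt K n) : lstar K n (lstar K n a) = a := by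
  induction a using induction_on with
  | scalar r => simp [lstar, AlgHom.commutes]
  | hx i => simp [lstar, lstarHom_lx, lstarHom_ly]
  | hy i => simp [lstar, lstarHom_lx, lstarHom_ly]
  | mul a b ha hb => rw [lstar_mul, lstar_mul, ha, hb]
  | add a b ha hb =>
    simp only [lstar, map_add, MulOpposite.unop_add] at ha hb ⊢
    rw [ha, hb]

noncomputable instance : StarRing (Leavitt K n) where
  star := lstar K n
  star_involutive := lstar_lstar
  star_mul := lstar_mul
  star_add a b := by simp [lstar]

@[simp]
theorem star_lx (i : Fin n) : star (lx K n i) = ly K n i := by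
  change lstar K n _ = _
  rw [lstar, lstarHom_lx, MulOpposite.unop_op]

@[simp]
theorem star_ly (i : Fin n) : star (ly K n i) = lx K n i := by
  change lstar K n _ = _
  rw [lstar, lstarHom_ly, MulOpposite.unop_op]

@[simp] theorem yW_nil : yW K n [] = 1 := rfl

@[simp] theorem xW_nil : xW K n [] = 1 := rfl

theorem yW_cons (i : Fin n) (I : List (Fin n)) : yW K n (i :: I) = ly K n i * yW K n I := by
  simp [yW]

theorem xW_cons (i : Fin n) (I : List (Fin n)) : xW K n (i :: I) = xW K n I * lx K n i := by
  simp [xW]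

theorem yW_append (I J : List (Fin n)) : yW K n (I ++ J) = yW K n I * yW K n J := by
  simp [yW]

theorem xW_append (I J : List (Fin n)) : xW K n (I ++ J) = xW K n J * xW K n I := by
  simp [xW]

@[simp]
theorem star_yW (I : List (Fin n)) : star (yW K n I) = xW K n I := by
  induction I with
  | nil => simp
  | cons i I ih => rw [yW_cons, xW_cons, star_mul, ih, star_ly]

theorem xW_mul_yW_append (I J : List (Fin n)) : xW K n I * yW K n (I ++ J) = yW K n J := by
  induction I with
  | nil => simp
  | cons i I ih =>
    rw [List.cons_append, xW_cons, yW_cons, mul_assoc, ← mul_assoc (lx K n i), lx_mul_ly,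
      if_pos rfl, one_mul, ih]

theorem xW_mul_yW_self (I : List (Fin n)) : xW K n I * yW K n I = 1 := by
  simpa using xW_mul_yW_append (K := K) I []

theorem xW_mul_yW_eq_zero {I J : List (Fin n)} (h₁ : ¬ I <+: J) (h₂ : ¬ J <+: I) :
    xW K n I * yW K n J = 0 := by
  induction I generalizing J with
  | nil => simp at h₁
  | cons i I ih =>
    cases J with
    | nil => simp at h₂
    | cons j J =>
      rw [xW_cons, yW_cons, mul_assoc, ← mul_assoc (lx K n i), lx_mul_ly]
      by_cases hij : i = j
      · subst hij
        rw [if_pos rfl, one_mul]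
        exact ih (by simpa using h₁) (by simpa using h₂)
      · simp [hij]

theorem eq_zero_of_mul_yW_eq_zero {a : Leavitt K n} (N : ℕ)
    (h : ∀ W : List (Fin n), W.length = N → a * yW K n W = 0) : a = 0 := by
  induction N with
  | zero => simpa using h [] rfl
  | succ N ih =>
    refine ih fun W hW => ?_
    rw [← mul_one (a * yW K n W), ← sum_ly_mul_lx, Finset.mul_sum]
    refine Finset.sum_eq_zero fun j _ => ?_
    have := h (W ++ [j]) (by simp [hW])
    rw [yW_append, yW_cons, yW_nil, mul_one, ← mul_assoc] at this
    rw [← mul_assoc, this, zero_mul]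

theorem exists_mul_yW_mem_span (a : Leavitt K n) :
    ∃ N, ∀ W : List (Fin n), N ≤ W.length →
      a * yW K n W ∈ Submodule.span K (Set.range (yW K n)) := by
  induction a using induction_on with
  | scalar r =>
    refine ⟨0, fun W _ => ?_⟩
    rw [← Algebra.smul_def]
    exact Submodule.smul_mem _ _ (Submodule.subset_span ⟨W, rfl⟩)
  | hx i =>
    refine ⟨1, fun W hW => ?_⟩
    cases W with
    | nil => simp at hW
    | cons j W =>
      rw [yW_cons, ← mul_assoc, lx_mul_ly]
      split_ifs
      · rw [one_mul]
        exact Submodule.subset_span ⟨W, rfl⟩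
      · simp
  | hy i => exact ⟨0, fun W _ => Submodule.subset_span ⟨i :: W, yW_cons i W⟩⟩
  | mul a b ha hb =>
    obtain ⟨M, hM⟩ := ha
    obtain ⟨N, hN⟩ := hb
    refine ⟨N + M, fun W hW => ?_⟩
    rw [← List.take_append_drop N W, yW_append, ← mul_assoc, mul_assoc a]
    have key : ∀ p ∈ Submodule.span K (Set.range (yW K n)),
        a * p * yW K n (W.drop N) ∈ Submodule.span K (Set.range (yW K n)) := by
      intro p hp
      induction hp using Submodule.span_induction with
      | mem x hx =>
        obtain ⟨V, rfl⟩ := hx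
        rw [mul_assoc, ← yW_append]
        exact hM _ (by simp; omega)
      | zero => simp
      | add x y _ _ hx hy => rw [mul_add, add_mul]; exact add_mem hx hy
      | smul c x _ hx =>
        rw [mul_smul_comm, smul_mul_assoc]
        exact Submodule.smul_mem _ _ hx
    exact key _ (hN _ (by simp; omega))
  | add a b ha hb =>
    obtain ⟨M, hM⟩ := ha
    obtain ⟨N, hN⟩ := hb
    refine ⟨max M N, fun W hW => ?_⟩
    rw [add_mul]
    exact add_mem (hM W (by omega)) (hN W (by omega))

/-- The word `i ⋯ i j` with `j ≠ i` is not a proper suffix-shift of itself by less than its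
length. -/
theorem not_prefix_append_replicate {i j : Fin n} (hij : i ≠ j) {M : ℕ} {V : List (Fin n)}
    (hV : V ≠ []) (hM : V.length ≤ M) :
    ¬ (List.replicate M i ++ [j]) <+: V ++ (List.replicate M i ++ [j]) := by
  intro h
  have hpos := List.length_pos_iff.2 hV
  have h₁ := List.prefix_iff_getElem?.1 h M (by simp)
  rw [List.getElem?_append_right hM, List.getElem?_append_left (by simp; omega)] at h₁
  rw [List.getElem?_eq_getElem (by simp; omega)] at h₁
  simp at h₁
  exact hij h₁

theorem exists_mul_mul_eq_smul_one (hn : 2 ≤ n) {a : Leavitt K n} (ha : a ≠ 0) :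
    ∃ (b b' : Leavitt K n) (c : K), c ≠ 0 ∧ b * a * b' = c • (1 : Leavitt K n) := by
  obtain ⟨N, hN⟩ := exists_mul_yW_mem_span a
  obtain ⟨W, hW, hne⟩ : ∃ W : List (Fin n), W.length = N ∧ a * yW K n W ≠ 0 := by
    by_contra! h
    exact ha (eq_zero_of_mul_yW_eq_zero N h)
  obtain ⟨f, hf⟩ := (Finsupp.mem_span_range_iff_exists_finsupp).1 (hN W hW.ge)
  have hf0 : f.support.Nonempty := by
    rw [Finsupp.support_nonempty_iff]
    rintro rfl
    exact hne (by simpa using hf.symm)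
  obtain ⟨V, hV, hmin⟩ := Finset.exists_min_image f.support List.length hf0
  obtain ⟨i, j, hij⟩ : ∃ i j : Fin n, i ≠ j :=
    ⟨⟨0, by omega⟩, ⟨1, by omega⟩, by simp⟩
  set U := List.replicate (f.support.sup List.length) i ++ [j] with hU
  refine ⟨xW K n (V ++ U), yW K n W * yW K n U, f V, Finsupp.mem_support_iff.1 hV, ?_⟩
  rw [mul_assoc, ← mul_assoc a, ← hf, Finsupp.sum, Finset.sum_mul, Finset.mul_sum,
    Finset.sum_eq_single V]
  · rw [smul_mul_assoc, mul_smul_comm, ← yW_append, xW_mul_yW_self]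
  · intro V' hV' hne
    rw [smul_mul_assoc, mul_smul_comm, ← yW_append]
    have hle := hmin V' hV'
    have hsup : V'.length ≤ f.support.sup List.length := Finset.le_sup hV'
    rw [xW_mul_yW_eq_zero, smul_zero]
    · intro h
      have hp : V <+: V' :=
        List.prefix_of_prefix_length_le ((List.prefix_append V U).trans h)
          (List.prefix_append V' U) hle
      obtain ⟨T, rfl⟩ := hp
      rw [List.append_assoc, List.prefix_append_right_inj] at h
      refine not_prefix_append_replicate hij ?_ ?_ h
      · rintro rfl
        simp at hne
      · simp at hsup
        exact le_trans (by omega) hsup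
    · intro h
      have hp : V <+: V' :=
        List.prefix_of_prefix_length_le (List.prefix_append V U)
          ((List.prefix_append V' U).trans h) hle
      have := h.length_le
      simp only [List.length_append] at this
      exact hne (hp.eq_of_length (by omega)).symm
  · intro h
    exact absurd hV h

theorem algHom_injective (hn : 2 ≤ n) {A : Type*} [Semiring A] [Algebra K A]
    (φ : Leavitt K n →ₐ[K] A) (h : (1 : A) = 0 → (1 : Leavitt K n) = 0) :
    Function.Injective φ := by
  intro a b hab
  by_contra hne
  obtain ⟨u, v, c, hc, huv⟩ := exists_mul_mul_eq_smul_one hn (sub_ne_zero.2 hne)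
  have hφ : φ (u * a * v) = φ (u * b * v) := by simp only [map_mul, hab]
  have h0 : u * a * v = u * b * v + c • (1 : Leavitt K n) := by
    rw [← huv, mul_sub, sub_mul, add_sub_cancel]
  rw [h0, map_add, map_smul, map_one] at hφ
  have hneg : φ (-(u * b * v)) + φ (u * b * v) = 0 := by rw [← map_add]; simp
  have h1 : (c • (1 : A)) = 0 := by
    have := congrArg (φ (-(u * b * v)) + ·) hφ
    simpa only [← add_assoc, hneg, zero_add] using this
  have h2 : (1 : A) = 0 := by
    rw [← one_smul K (1 : A), ← inv_mul_cancel₀ hc, mul_smul, h1, smul_zero]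
  have h3 := h h2
  exact hne (by rw [← mul_one a, ← mul_one b, h3, mul_zero, mul_zero])

end Algebra

section Positive

variable (K : Type) [Field K] (n : ℕ)

/-- The subsemiring of `L_n` generated by the `x_i` and the `y_i`. -/
noncomputable def positive : Subsemiring (Leavitt K n) :=
  Subsemiring.closure (Set.range (lx K n) ∪ Set.range (ly K n))

variable {K n}

theorem lx_mem_positive (i : Fin n) : lx K n i ∈ positive K n :=
  Subsemiring.subset_closure (Or.inl ⟨i, rfl⟩)

theorem ly_mem_positive (i : Fin n) : ly K n i ∈ positive K n :=
  Subsemiring.subset_closure (Or.inr ⟨i, rfl⟩)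

theorem yW_mem_positive (I : List (Fin n)) : yW K n I ∈ positive K n := by
  induction I with
  | nil => exact one_mem _
  | cons i I ih => rw [yW_cons]; exact mul_mem (ly_mem_positive i) ih

theorem xW_mem_positive (I : List (Fin n)) : xW K n I ∈ positive K n := by
  induction I with
  | nil => exact one_mem _
  | cons i I ih => rw [xW_cons]; exact mul_mem ih (lx_mem_positive i)

theorem positive_induction {p : (a : Leavitt K n) → a ∈ positive K n → Prop}
    (hx : ∀ i, p (lx K n i) (lx_mem_positive i)) (hy : ∀ i, p (ly K n i) (ly_mem_positive i))
    (zero : p 0 (zero_mem _)) (one : p 1 (one_mem _))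
    (add : ∀ a b ha hb, p a ha → p b hb → p (a + b) (add_mem ha hb))
    (mul : ∀ a b ha hb, p a ha → p b hb → p (a * b) (mul_mem ha hb))
    {a : Leavitt K n} (ha : a ∈ positive K n) : p a ha := by
  refine Subsemiring.closure_induction (p := p) ?_ zero one add mul ha
  rintro _ (⟨i, rfl⟩ | ⟨i, rfl⟩)
  exacts [hx i, hy i]

theorem star_mem_positive {a : Leavitt K n} (ha : a ∈ positive K n) : star a ∈ positive K n := by
  induction ha using positive_induction with
  | hx i => rw [star_lx]; exact ly_mem_positive i
  | hy i => rw [star_ly]; exact lx_mem_positive i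
  | zero => rw [star_zero]; exact zero_mem _
  | one => rw [star_one]; exact one_mem _
  | add a b _ _ ha hb => rw [star_add]; exact add_mem ha hb
  | mul a b _ _ ha hb => rw [star_mul]; exact mul_mem hb ha

theorem eq_zero_or_monomial {a : Leavitt K n}
    (ha : a ∈ Submonoid.closure (Set.range (lx K n) ∪ Set.range (ly K n))) :
    a = 0 ∨ ∃ I J, a = yW K n I * xW K n J := by
  induction ha using Submonoid.closure_induction_left with
  | one => exact Or.inr ⟨[], [], by simp⟩
  | mul_left u hu b _ ih =>
    obtain rfl | ⟨I, J, rfl⟩ := ih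
    · exact Or.inl (mul_zero u)
    obtain ⟨i, rfl⟩ | ⟨i, rfl⟩ := hu
    · cases I with
      | nil => exact Or.inr ⟨[], J ++ [i], by simp [xW_append, xW_cons]⟩
      | cons j I =>
        rw [yW_cons, ← mul_assoc, ← mul_assoc, lx_mul_ly]
        split_ifs
        · exact Or.inr ⟨I, J, by rw [one_mul]⟩
        · exact Or.inl (by simp)
    · exact Or.inr ⟨i :: I, J, by rw [yW_cons, mul_assoc]⟩

theorem isSumYX_zero : IsSumYX K n 0 := ⟨0, Fin.elim0, Fin.elim0, by simp⟩

theorem isSumYX_iff {a : Leavitt K n} : IsSumYX K n a ↔ a ∈ positive K n := by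
  constructor
  · rintro ⟨m, I, J, rfl⟩
    exact sum_mem fun i _ => mul_mem (yW_mem_positive _) (xW_mem_positive _)
  · intro ha
    rw [positive, Subsemiring.mem_closure_iff] at ha
    induction ha using AddSubmonoid.closure_induction with
    | mem a ha =>
      obtain rfl | ⟨I, J, rfl⟩ := eq_zero_or_monomial ha
      · exact isSumYX_zero
      · exact ⟨1, fun _ => I, fun _ => J, by simp⟩
    | zero => exact isSumYX_zero
    | add a b _ _ ha hb =>
      obtain ⟨k, I, J, rfl⟩ := ha
      obtain ⟨l, I', J', rfl⟩ := hb
      exact ⟨k + l, Fin.append I I', Fin.append J J', by simp [Fin.sum_univ_add]⟩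

theorem mul_apply_mem_positive {ι κ τ : Type} [Fintype κ] {A : Matrix ι κ (Leavitt K n)}
    {B : Matrix κ τ (Leavitt K n)} (hA : ∀ i j, A i j ∈ positive K n)
    (hB : ∀ i j, B i j ∈ positive K n) (i : ι) (j : τ) : (A * B) i j ∈ positive K n := by
  rw [Matrix.mul_apply]
  exact sum_mem fun k _ => mul_mem (hA i k) (hB k j)

end Positive

section PositiveUnitary

variable (K : Type) [Field K] (n : ℕ) (ι κ : Type) [Fintype ι] [DecidableEq ι]
  [Fintype κ] [DecidableEq κ]

/-- The monoid of unitary matrices over `L_n` with entries in the positive subsemiring. -/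
def positiveUnitary : Submonoid (Matrix ι ι (Leavitt K n)) where
  carrier := {A | (A * star A = 1 ∧ star A * A = 1) ∧ ∀ i j, A i j ∈ positive K n}
  one_mem' := by
    refine ⟨by simp, fun i j => ?_⟩
    rw [Matrix.one_apply]
    split_ifs
    exacts [one_mem _, zero_mem _]
  mul_mem' := by
    rintro A B ⟨⟨h₁, h₂⟩, h₃⟩ ⟨⟨h₄, h₅⟩, h₆⟩
    refine ⟨⟨?_, ?_⟩, fun i j => ?_⟩
    · rw [star_mul, mul_assoc, ← mul_assoc B, h₄, one_mul, h₁]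
    · rw [star_mul, mul_assoc, ← mul_assoc _ A, h₂, one_mul, h₅]
    · rw [Matrix.mul_apply]
      exact sum_mem fun k _ => mul_mem (h₃ i k) (h₆ k j)

variable {K n ι κ}

/-- An injective unital multiplicative map which on positive matrices respects the involution and
surjects onto positive matrices identifies the groups of positive unitary matrices. -/
theorem nonempty_mulEquiv_of_monoidHom
    (F : Matrix ι ι (Leavitt K n) →* Matrix κ κ (Leavitt K n)) (hinj : Function.Injective F)
    (hstar : ∀ A : Matrix ι ι (Leavitt K n), (∀ i j, A i j ∈ positive K n) →
      F (star A) = star (F A))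
    (hpos : ∀ A : Matrix ι ι (Leavitt K n), (∀ i j, A i j ∈ positive K n) →
      ∀ i j, F A i j ∈ positive K n)
    (hsurj : ∀ B : Matrix κ κ (Leavitt K n), (∀ i j, B i j ∈ positive K n) →
      ∃ A : Matrix ι ι (Leavitt K n), (∀ i j, A i j ∈ positive K n) ∧ F A = B) :
    Nonempty (positiveUnitary K n ι ≃* positiveUnitary K n κ) := by
  have hF : ∀ A ∈ positiveUnitary K n ι, F A ∈ positiveUnitary K n κ := by
    rintro A ⟨⟨h₁, h₂⟩, h₃⟩
    refine ⟨⟨?_, ?_⟩, hpos A h₃⟩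
    · rw [← hstar A h₃, ← map_mul, h₁, map_one]
    · rw [← hstar A h₃, ← map_mul, h₂, map_one]
  refine ⟨MulEquiv.ofBijective
    ((F.comp (positiveUnitary K n ι).subtype).codRestrict (positiveUnitary K n κ)
      fun A => hF A A.2) ⟨fun A B h => Subtype.ext (hinj (congrArg Subtype.val h)), ?_⟩⟩
  rintro ⟨B, ⟨h₁, h₂⟩, h₃⟩
  obtain ⟨A, hA, rfl⟩ := hsurj B h₃
  refine ⟨⟨A, ⟨hinj ?_, hinj ?_⟩, hA⟩, rfl⟩
  · rw [map_mul, hstar A hA, h₁, map_one]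
  · rw [map_mul, hstar A hA, h₂, map_one]

theorem nonempty_mulEquiv_of_unitary (U : Matrix κ ι (Leavitt K n))
    (hU : U * U.conjTranspose = 1) (hU' : U.conjTranspose * U = 1)
    (hpos : ∀ i j, U i j ∈ positive K n) :
    Nonempty (positiveUnitary K n ι ≃* positiveUnitary K n κ) := by
  have hpos' : ∀ i j, U.conjTranspose i j ∈ positive K n := fun i j =>
    star_mem_positive (hpos j i)
  have hinv : ∀ A : Matrix ι ι (Leavitt K n),
      U.conjTranspose * (U * A * U.conjTranspose) * U = A := fun A => by
    rw [← Matrix.mul_assoc, ← Matrix.mul_assoc, hU', Matrix.one_mul, Matrix.mul_assoc, hU',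
      Matrix.mul_one]
  let F : Matrix ι ι (Leavitt K n) →* Matrix κ κ (Leavitt K n) :=
    { toFun := fun A => U * A * U.conjTranspose
      map_one' := by rw [Matrix.mul_one, hU]
      map_mul' := fun A B => by
        simp only [Matrix.mul_assoc]
        rw [← Matrix.mul_assoc U.conjTranspose U, hU', Matrix.one_mul] }
  refine nonempty_mulEquiv_of_monoidHom F
    (fun A B h => ?_) (fun A _ => ?_) (fun A hA => ?_) (fun B hB => ?_)
  · rw [← hinv A, ← hinv B]
    exact congrArg (fun C => U.conjTranspose * C * U) h
  · simp [F, Matrix.star_eq_conjTranspose, Matrix.conjTranspose_mul, Matrix.mul_assoc]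
  · exact mul_apply_mem_positive (mul_apply_mem_positive hpos hA) hpos'
  · refine ⟨U.conjTranspose * B * U,
      mul_apply_mem_positive (mul_apply_mem_positive hpos' hB) hpos, ?_⟩
    change U * (U.conjTranspose * B * U) * U.conjTranspose = B
    rw [← Matrix.mul_assoc, ← Matrix.mul_assoc, hU, Matrix.one_mul, Matrix.mul_assoc, hU,
      Matrix.mul_one]

theorem nonempty_mulEquiv_of_equiv (e : ι ≃ κ) :
    Nonempty (positiveUnitary K n ι ≃* positiveUnitary K n κ) :=
  nonempty_mulEquiv_of_monoidHom (Matrix.reindexRingEquiv (Leavitt K n) e : _ →* _)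
    (Matrix.reindexRingEquiv (Leavitt K n) e).injective
    (fun A _ => by ext; simp [Matrix.star_apply]) (fun A hA i j => hA _ _)
    (fun B hB => ⟨Matrix.reindex e.symm e.symm B, fun i j => hB _ _, by ext; simp⟩)

/-- The column `(x_1, …, x_n)` splits one coordinate of a matrix into `n` coordinates. -/
theorem nonempty_mulEquiv_split :
    Nonempty (positiveUnitary K n (ι ⊕ Unit) ≃* positiveUnitary K n (ι ⊕ Fin n)) := by
  let c : Matrix (Fin n) Unit (Leavitt K n) := Matrix.of fun i _ => lx K n i
  have h₁ : c * c.conjTranspose = 1 := by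
    ext i j
    simp [c, Matrix.mul_apply, lx_mul_ly, Matrix.one_apply]
  have h₂ : c.conjTranspose * c = 1 := by
    ext i j
    simp [c, Matrix.mul_apply, sum_ly_mul_lx]
  refine nonempty_mulEquiv_of_unitary (Matrix.fromBlocks 1 0 0 c) ?_ ?_ ?_
  · simp [Matrix.fromBlocks_conjTranspose, Matrix.fromBlocks_multiply, h₁]
  · simp [Matrix.fromBlocks_conjTranspose, Matrix.fromBlocks_multiply, h₂]
  · rintro (i | i) (j | j)
    · rw [Matrix.fromBlocks_apply₁₁, Matrix.one_apply]
      split_ifs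
      exacts [one_mem _, zero_mem _]
    · exact zero_mem _
    · exact zero_mem _
    · exact lx_mem_positive i

end PositiveUnitary

section Expansion

variable {K : Type} [Field K] {n : ℕ} {ι Λ : Type} [DecidableEq ι]
  (root : Λ → ι) (word : Λ → List (Fin n)) (e : Λ ≃ Fin n × ι)

variable (K) in
/-- The matrix whose column `a` is the monomial `y_w` in row `b`, where `b` and `w` are the root and
the word of the leaf sitting at `(i, a)`. -/
noncomputable def leafMatrix (i : Fin n) : Matrix ι ι (Leavitt K n) :=
  Matrix.of fun b a =>
    if root (e.symm (i, a)) = b then yW K n (word (e.symm (i, a))) else 0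

theorem leafMatrix_mem_positive (i : Fin n) (a b : ι) :
    leafMatrix K root word e i a b ∈ positive K n := by
  rw [leafMatrix, Matrix.of_apply]
  split_ifs
  exacts [yW_mem_positive _, zero_mem _]

variable {root word} [Fintype ι]

theorem star_leafMatrix_mul_leafMatrix [DecidableEq Λ]
    (horth : ∀ l l', root l = root l' →
      xW K n (word l) * yW K n (word l') = if l = l' then 1 else 0) (i j : Fin n) :
    star (leafMatrix K root word e i) * leafMatrix K root word e j = if i = j then 1 else 0 := by
  ext a a'
  have h : (star (leafMatrix K root word e i) * leafMatrix K root word e j) a a' =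
      if e.symm (i, a) = e.symm (j, a') then 1 else 0 := by
    rw [Matrix.mul_apply, Finset.sum_eq_single (root (e.symm (i, a)))]
    · simp only [leafMatrix, Matrix.star_apply, Matrix.of_apply, if_true, star_yW, mul_ite,
        mul_zero]
      split_ifs with h₁ h₂ h₂
      · rw [horth _ _ h₁.symm, if_pos h₂]
      · rw [horth _ _ h₁.symm, if_neg h₂]
      · exact absurd (congrArg root h₂).symm h₁
      · rfl
    · intro b _ hb
      simp [leafMatrix, Matrix.star_apply, hb.symm]
    · simp
  rw [h]
  by_cases hij : i = j
  · simp [hij, Matrix.one_apply]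
  · simp [hij]

theorem sum_leafMatrix_mul_star [Fintype Λ]
    (hcomp : ∀ b, ∑ l, (if root l = b then yW K n (word l) * xW K n (word l) else 0) = 1) :
    ∑ i, leafMatrix K root word e i * star (leafMatrix K root word e i) = 1 := by
  ext b b'
  have h : ∀ i, (leafMatrix K root word e i * star (leafMatrix K root word e i)) b b' =
      ∑ a, (if root (e.symm (i, a)) = b ∧ root (e.symm (i, a)) = b' then
        yW K n (word (e.symm (i, a))) * xW K n (word (e.symm (i, a))) else 0) := by
    intro i
    rw [Matrix.mul_apply]
    refine Finset.sum_congr rfl fun a _ => ?_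
    simp only [leafMatrix, Matrix.star_apply, Matrix.of_apply]
    by_cases h₁ : root (e.symm (i, a)) = b
    · by_cases h₂ : root (e.symm (i, a)) = b'
      · rw [if_pos h₁, if_pos h₂, if_pos ⟨h₁, h₂⟩, star_yW]
      · rw [if_neg h₂, star_zero, mul_zero, if_neg fun h => h₂ h.2]
    · rw [if_neg h₁, zero_mul, if_neg fun h => h₁ h.1]
  rw [Matrix.sum_apply, Finset.sum_congr rfl fun i _ => h i, ← Fintype.sum_prod_type'
    (f := fun i a => if root (e.symm (i, a)) = b ∧ root (e.symm (i, a)) = b' then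
        yW K n (word (e.symm (i, a))) * xW K n (word (e.symm (i, a))) else 0),
    e.symm.sum_comp (fun l => if root l = b ∧ root l = b' then
        yW K n (word l) * xW K n (word l) else 0), Matrix.one_apply]
  split_ifs with hb
  · subst hb
    simpa using hcomp b
  · refine Finset.sum_eq_zero fun l _ => if_neg ?_
    rintro ⟨rfl, rfl⟩
    exact hb rfl

variable (K) in
/-- The diagonal idempotent supported on the rows selected by `p`. -/
def indicator (p : ι → Bool) : Matrix ι ι (Leavitt K n) :=
  Matrix.diagonal fun a => if p a then 1 else 0

theorem indicator_mul_leafMatrix (p : ι → Bool) (i : Fin n) :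
    indicator K p * leafMatrix K root word e i =
      leafMatrix K root word e i * indicator K fun a => p (root (e.symm (i, a))) := by
  ext b a
  rw [indicator, indicator, Matrix.diagonal_mul, Matrix.mul_diagonal]
  simp only [leafMatrix, Matrix.of_apply]
  by_cases h : root (e.symm (i, a)) = b
  · simp [h]
  · simp [h]

theorem indicator_mem_of_forall
    (hsum : ∑ i, leafMatrix K root word e i * star (leafMatrix K root word e i) = 1)
    {N : Subsemiring (Matrix ι ι (Leavitt K n))} (hN : ∀ A ∈ N, star A ∈ N)
    (hY : ∀ i, leafMatrix K root word e i ∈ N) {p : ι → Bool}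
    (hp : ∀ i, indicator K (fun a => p (root (e.symm (i, a)))) ∈ N) : indicator K p ∈ N := by
  rw [← mul_one (indicator K p), ← hsum, Finset.mul_sum]
  refine sum_mem fun i _ => ?_
  rw [← mul_assoc, indicator_mul_leafMatrix]
  exact mul_mem (mul_mem (hY i) (hp i)) (hN _ (hY i))

theorem leafMatrix_mul_single (l : Λ) :
    leafMatrix K root word e (e l).1 * Matrix.single (e l).2 (e l).2 1 =
      Matrix.single (root l) (e l).2 (yW K n (word l)) := by
  ext b a
  by_cases ha : a = (e l).2
  · subst ha
    rw [Matrix.mul_single_apply_same]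
    simp [leafMatrix, Matrix.single_apply]
  · rw [Matrix.mul_single_apply_of_ne _ _ _ _ _ ha, Matrix.single_apply_of_col_ne _ _ (Ne.symm ha)]

theorem exists_algHom_leafMatrix [Fintype Λ] [DecidableEq Λ]
    (horth : ∀ l l', root l = root l' →
      xW K n (word l) * yW K n (word l') = if l = l' then 1 else 0)
    (hcomp : ∀ b, ∑ l, (if root l = b then yW K n (word l) * xW K n (word l) else 0) = 1) :
    ∃ φ : Leavitt K n →ₐ[K] Matrix ι ι (Leavitt K n),
      (∀ i, φ (ly K n i) = leafMatrix K root word e i) ∧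
      (∀ i, φ (lx K n i) = star (leafMatrix K root word e i)) := by
  let f : FreeAlgebra K (Fin n ⊕ Fin n) →ₐ[K] Matrix ι ι (Leavitt K n) :=
    FreeAlgebra.lift K (Sum.elim (fun i => star (leafMatrix K root word e i))
      (leafMatrix K root word e))
  have hf : ∀ ⦃a b⦄, LeavittRel K n a b → f a = f b := by
    intro a b h
    induction h with
    | xy i j =>
      simp only [f, map_mul, FreeAlgebra.lift_ι_apply, Sum.elim_inl, Sum.elim_inr,
        star_leafMatrix_mul_leafMatrix e horth]
      split_ifs <;> simp
    | yx =>
      simp only [f, map_sum, map_mul, FreeAlgebra.lift_ι_apply, Sum.elim_inl, Sum.elim_inr,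
        sum_leafMatrix_mul_star e hcomp, map_one]
  refine ⟨RingQuot.liftAlgHom K ⟨f, hf⟩, fun i => ?_, fun i => ?_⟩
  · rw [ly, RingQuot.liftAlgHom_mkAlgHom_apply]
    simp [f]
  · rw [lx, RingQuot.liftAlgHom_mkAlgHom_apply]
    simp [f]

end Expansion

section Leaves

/-- Leaves of a forest of `(m + 1)`-ary trees with roots `0, …, D`: the roots other than `0` and `D`
are leaves, `0` has its `m + 1` children as leaves, and the tree at `D` is a comb of depth `D`. -/
abbrev Leaf (m D : ℕ) : Type :=
  {b : Fin (D + 1) // b ≠ 0 ∧ b ≠ Fin.last D} ⊕ Fin (m + 1) ⊕ Option (Fin D × Fin m)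

variable {m D : ℕ}

/-- The root above a leaf. -/
def leafRoot : Leaf m D → Fin (D + 1)
  | Sum.inl b => b
  | Sum.inr (Sum.inl _) => 0
  | Sum.inr (Sum.inr _) => Fin.last D

/-- The path from the root to a leaf. -/
def leafWord : Leaf m D → List (Fin (m + 1))
  | Sum.inl _ => []
  | Sum.inr (Sum.inl j) => [j]
  | Sum.inr (Sum.inr none) => List.replicate D 0
  | Sum.inr (Sum.inr (some (k, j))) => List.replicate k 0 ++ [j.succ]

theorem zero_ne_last (hD : D ≠ 0) : (0 : Fin (D + 1)) ≠ Fin.last D := fun h =>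
  hD (congrArg Fin.val h).symm

theorem replicate_append_prefix_iff {j j' : Fin m} {k k' : ℕ} :
    List.replicate k (0 : Fin (m + 1)) ++ [j.succ] <+: List.replicate k' 0 ++ [j'.succ] ↔
      k = k' ∧ j = j' := by
  induction k generalizing k' with
  | zero =>
    cases k' with
    | zero => simp [List.cons_prefix_cons]
    | succ k' => simp [List.replicate_succ, List.cons_prefix_cons]
  | succ k ih =>
    cases k' with
    | zero => simp [List.replicate_succ, List.cons_prefix_cons, (Fin.succ_ne_zero j').symm]
    | succ k' => simp [List.replicate_succ, List.cons_prefix_cons, ih]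

theorem not_replicate_append_prefix_replicate {j : Fin m} {k k' : ℕ} :
    ¬ List.replicate k (0 : Fin (m + 1)) ++ [j.succ] <+: List.replicate k' 0 := by
  intro h
  exact Fin.succ_ne_zero j (List.eq_of_mem_replicate (h.subset (by simp)))

theorem not_replicate_prefix_replicate_append {j : Fin m} {k k' : ℕ} (hk : k < k') :
    ¬ List.replicate k' (0 : Fin (m + 1)) <+: List.replicate k 0 ++ [j.succ] := by
  intro h
  have hl := h.length_le
  simp only [List.length_replicate, List.length_append, List.length_singleton] at hl
  have := h.eq_of_length (by simp; omega)
  have h' := not_replicate_append_prefix_replicate (j := j) (k := k) (k' := k')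
  rw [this] at h'
  exact h' (List.prefix_refl _)

variable (K : Type) [Field K]

theorem xW_leafWord_mul_yW_leafWord (hD : D ≠ 0) (l l' : Leaf m D) (h : leafRoot l = leafRoot l') :
    xW K (m + 1) (leafWord l) * yW K (m + 1) (leafWord l') = if l = l' then 1 else 0 := by
  have h0 := zero_ne_last hD
  split_ifs with hl
  · rw [hl, xW_mul_yW_self]
  · obtain ⟨b, hb⟩ | j | _ | ⟨k, j⟩ := l <;> obtain ⟨b', hb'⟩ | j' | _ | ⟨k', j'⟩ := l' <;>
      simp only [leafRoot] at h
    · exact absurd (by simp [h]) hl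
    · exact absurd h hb.1
    · exact absurd h hb.2
    · exact absurd h hb.2
    · exact absurd h.symm hb'.1
    · have : j ≠ j' := fun h => hl (by rw [h])
      refine xW_mul_yW_eq_zero ?_ ?_ <;> simp [leafWord, this, this.symm]
    · exact absurd h h0
    · exact absurd h h0
    · exact absurd h.symm hb'.2
    · exact absurd h.symm h0
    · exact absurd rfl hl
    · exact xW_mul_yW_eq_zero (not_replicate_prefix_replicate_append k'.2)
        not_replicate_append_prefix_replicate
    · exact absurd h.symm hb'.2
    · exact absurd h.symm h0
    · exact xW_mul_yW_eq_zero not_replicate_append_prefix_replicate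
        (not_replicate_prefix_replicate_append k.2)
    · have : ¬ ((k : ℕ) = k' ∧ j = j') := fun h => hl (by rw [Fin.ext h.1, h.2])
      refine xW_mul_yW_eq_zero ?_ ?_ <;> rw [leafWord, leafWord, replicate_append_prefix_iff]
      exacts [this, fun h => this ⟨h.1.symm, h.2.symm⟩]

theorem sum_replicate (k : ℕ) :
    yW K (m + 1) (List.replicate k 0) * xW K (m + 1) (List.replicate k 0) +
      ∑ i : Fin k, ∑ j : Fin m, yW K (m + 1) (List.replicate i 0 ++ [j.succ]) *
        xW K (m + 1) (List.replicate i 0 ++ [j.succ]) = 1 := by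
  induction k with
  | zero => simp
  | succ k ih =>
    rw [Fin.sum_univ_castSucc, ← ih, ← add_assoc, add_right_comm]
    congr 1
    simp only [Fin.val_last]
    rw [List.replicate_succ', yW_append, xW_append]
    simp only [yW_append, xW_append]
    have h := sum_ly_mul_lx (K := K) (n := m + 1)
    rw [Fin.sum_univ_succ] at h
    have h' := congrArg (fun a => yW K (m + 1) (List.replicate k 0) * a *
      xW K (m + 1) (List.replicate k 0)) h
    simpa [yW_cons, xW_cons, mul_assoc, add_mul, mul_add, Finset.mul_sum, Finset.sum_mul] using h'

theorem sum_leafWord (hD : D ≠ 0) (b : Fin (D + 1)) :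
    ∑ l : Leaf m D, (if leafRoot l = b then
      yW K (m + 1) (leafWord l) * xW K (m + 1) (leafWord l) else 0) = 1 := by
  have h0 := zero_ne_last hD
  rw [Fintype.sum_sum_type, Fintype.sum_sum_type, Fintype.sum_option, Fintype.sum_prod_type]
  change (∑ x : {b : Fin (D + 1) // b ≠ 0 ∧ b ≠ Fin.last D}, if x.1 = b then
      yW K (m + 1) [] * xW K (m + 1) [] else 0) +
    ((∑ j : Fin (m + 1), if 0 = b then yW K (m + 1) [j] * xW K (m + 1) [j] else 0) +
      ((if Fin.last D = b then yW K (m + 1) (List.replicate D 0) *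
        xW K (m + 1) (List.replicate D 0) else 0) +
      ∑ i : Fin D, ∑ j : Fin m, if Fin.last D = b then
        yW K (m + 1) (List.replicate i 0 ++ [j.succ]) *
          xW K (m + 1) (List.replicate i 0 ++ [j.succ]) else 0)) = 1
  rcases eq_or_ne b 0 with rfl | hb0
  · rw [Finset.sum_eq_zero fun x _ => if_neg x.2.1]
    simp [h0.symm, yW_cons, xW_cons, sum_ly_mul_lx]
  rcases eq_or_ne b (Fin.last D) with rfl | hbl
  · rw [Finset.sum_eq_zero fun x _ => if_neg x.2.2]
    simp only [h0, if_false, if_true, Finset.sum_const_zero, zero_add]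
    exact sum_replicate K D
  · rw [Finset.sum_eq_single ⟨b, hb0, hbl⟩ (fun x _ hx => if_neg fun h => hx (Subtype.ext h))
      (by simp)]
    simp [hb0.symm, hbl.symm]

end Leaves

section Placement

/-- A bijection between leaves and slots `(i, a)` which is explicit on the leaves of depth at most
one, together with a compatible `2`-colouring of the roots. -/
structure Placement (m D : ℕ) where
  /-- The slot of each leaf. -/
  toEquiv : Leaf m D ≃ Fin (m + 1) × Fin (D + 1)
  /-- The colour of each root. -/
  label : Fin (D + 1) → Bool
  mid : ∀ b hb, toEquiv (Sum.inl ⟨b, hb⟩) =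
    (if b.1 + m < D + 1 then 0 else 1, b + Fin.ofNat (D + 1) m)
  zero : ∀ j : Fin (m + 1), toEquiv (Sum.inr (Sum.inl j)) = (0, Fin.ofNat (D + 1) j)
  label_zero : label 0 = true
  label_last : label (Fin.last D) = false
  label_add : ∀ a, a ≠ 0 → a ≠ Fin.last D → label (a + Fin.ofNat (D + 1) m) = label a
  label_none : label (toEquiv (Sum.inr (Sum.inr none))).2 = true
  label_some : ∀ k j, label (toEquiv (Sum.inr (Sum.inr (some (k, j))))).2 =
    label (Fin.ofNat (D + 1) (j + 1))

variable {m D : ℕ}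

theorem shift_induction (hcop : Nat.Coprime m (D + 1)) {Q : Fin (D + 1) → Prop} (zero : Q 0)
    (step : ∀ c, c ≠ 0 → Q (c + Fin.ofNat (D + 1) m) → Q c) (c : Fin (D + 1)) : Q c := by
  obtain ⟨t, ht⟩ : ∃ t : ℕ, (c.1 + t * m) % (D + 1) = 0 := by
    obtain ⟨x, hx⟩ := Nat.exists_mul_mod_eq_of_coprime (D * c.1) hcop (by omega)
    refine ⟨x, ?_⟩
    have h1 : (x * m + c.1) ≡ (D * c.1 + c.1) [MOD (D + 1)] :=
      Nat.ModEq.add_right _ (by rw [Nat.ModEq, mul_comm x m, hx.2])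
    rw [add_comm, h1, show D * c.1 + c.1 = (D + 1) * c.1 by ring, Nat.mul_mod_right]
  induction t generalizing c with
  | zero =>
    have : c = 0 := by
      apply Fin.ext
      rw [zero_mul, add_zero, Nat.mod_eq_of_lt c.2] at ht
      simpa using ht
    exact this ▸ zero
  | succ t ih =>
    by_cases hc : c = 0
    · exact hc ▸ zero
    · refine step c hc (ih _ ?_)
      rw [Fin.val_add, Fin.val_ofNat, Nat.mod_add_mod, add_right_comm, Nat.add_mod_mod, ← ht]
      congr 1
      ring

namespace Placement

variable (p : Placement m D)

theorem symm_zero_of_le {a : Fin (D + 1)} (ha : a.1 ≤ m) :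
    p.toEquiv.symm (0, a) = Sum.inr (Sum.inl ⟨a, Nat.lt_succ_of_le ha⟩) := by
  rw [Equiv.symm_apply_eq, p.zero, Prod.mk.injEq]
  exact ⟨rfl, Fin.ext (by simp)⟩

theorem symm_zero_of_lt (hm : m ≠ 0) {a : Fin (D + 1)} (ha : m < a.1) :
    ∃ b hb, b.1 + m = a.1 ∧ p.toEquiv.symm (0, a) = Sum.inl ⟨b, hb⟩ := by
  have hlt := a.2
  refine ⟨⟨a - m, by omega⟩, ⟨fun h => ?_, fun h => ?_⟩, by simp; omega, ?_⟩
  · have := congrArg Fin.val h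
    simp only [Fin.val_zero] at this
    omega
  · have := congrArg Fin.val h
    simp only [Fin.val_last] at this
    omega
  · rw [Equiv.symm_apply_eq, p.mid, if_pos (by simp only; omega), Prod.mk.injEq]
    refine ⟨rfl, Fin.ext ?_⟩
    rw [Fin.val_add, Fin.val_ofNat, Nat.add_mod_mod, Nat.mod_eq_of_lt] <;> simp only <;> omega

theorem symm_one_of_lt (hmD : m ≤ D) {a : Fin (D + 1)} (ha : a.1 + 1 < m) :
    ∃ b hb, b.1 + m = a.1 + (D + 1) ∧ p.toEquiv.symm (1, a) = Sum.inl ⟨b, hb⟩ := by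
  refine ⟨⟨a + (D + 1) - m, by omega⟩, ⟨fun h => ?_, fun h => ?_⟩, by simp; omega, ?_⟩
  · have := congrArg Fin.val h
    simp only [Fin.val_zero] at this
    omega
  · have := congrArg Fin.val h
    simp only [Fin.val_last] at this
    omega
  · rw [Equiv.symm_apply_eq, p.mid, if_neg (by simp only; omega), Prod.mk.injEq]
    refine ⟨rfl, Fin.ext ?_⟩
    rw [Fin.val_add, Fin.val_ofNat, Nat.add_mod_mod]
    simp only
    rw [Nat.sub_add_cancel (by omega), Nat.add_mod_right, Nat.mod_eq_of_lt a.2]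

theorem root_symm_eq_last (hm : m ≠ 0) {i : Fin (m + 1)} (hi : i ≠ 0) {a : Fin (D + 1)}
    (ha : i = 1 → m ≤ a.1 + 1) : leafRoot (p.toEquiv.symm (i, a)) = Fin.last D := by
  have h10 : (1 : Fin (m + 1)) ≠ 0 := fun h => hm (by simpa using h)
  generalize hl : p.toEquiv.symm (i, a) = l
  rw [Equiv.symm_apply_eq] at hl
  obtain ⟨b, hb⟩ | j | o := l
  · rw [p.mid, Prod.mk.injEq] at hl
    obtain ⟨h1, h2⟩ := hl
    have hbl : b.1 ≠ D := fun h => hb.2 (Fin.ext h)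
    have hlt := b.2
    split_ifs at h1 with h
    · exact absurd h1 hi
    · have h3 := congrArg Fin.val h2
      have hmD : m ≤ a.1 + 1 := ha h1
      have := a.2
      rw [Fin.val_add, Fin.val_ofNat, Nat.add_mod_mod, Nat.mod_eq_sub_mod (by omega),
        Nat.mod_eq_of_lt (by omega)] at h3
      omega
  · rw [p.zero, Prod.mk.injEq] at hl
    exact absurd hl.1 hi
  · rfl

end Placement

section Generation

variable {K : Type} [Field K] (p : Placement m D)
  {N : Subsemiring (Matrix (Fin (D + 1)) (Fin (D + 1)) (Leavitt K (m + 1)))}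

theorem indicator_lt_mem (hm : m ≠ 0) (hmD : m ≤ D) (hcop : Nat.Coprime m (D + 1))
    (hN : ∀ A ∈ N, star A ∈ N)
    (hY : ∀ i, leafMatrix K leafRoot leafWord p.toEquiv i ∈ N) (c : Fin (D + 1)) :
    indicator K (fun a => decide (a < c)) ∈ N ∧ indicator K (fun a => !decide (a < c)) ∈ N := by
  have hsum := sum_leafMatrix_mul_star p.toEquiv (sum_leafWord K (m := m) (D := D) (by omega))
  have h0 : indicator K (fun _ => false) ∈ N := by
    simp [indicator]
  have h1 : indicator K (fun _ => true) ∈ N := by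
    simp [indicator]
  induction c using shift_induction hcop with
  | zero => exact ⟨by simpa using h0, by simpa using h1⟩
  | step c hc ih =>
    have hc0 : 0 < c.1 := Fin.pos_iff_ne_zero.2 hc
    have hlt := c.2
    have key : ∀ i, (∀ a, leafRoot (p.toEquiv.symm (i, a)) < c ↔ a < c + Fin.ofNat (D + 1) m) ∨
        (∀ a, leafRoot (p.toEquiv.symm (i, a)) < c) ∨
        (∀ a, ¬ leafRoot (p.toEquiv.symm (i, a)) < c) := by
      intro i
      by_cases hi0 : i = 0
      · subst hi0
        by_cases hcm : c.1 + m < D + 1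
        · refine Or.inl fun a => ?_
          rw [Fin.lt_def, Fin.lt_def, Fin.val_add, Fin.val_ofNat, Nat.add_mod_mod,
            Nat.mod_eq_of_lt hcm]
          obtain ha | ha := le_or_gt a.1 m
          · rw [p.symm_zero_of_le ha, leafRoot, Fin.val_zero]
            omega
          · obtain ⟨b, hb, hba, h⟩ := p.symm_zero_of_lt hm ha
            rw [h, leafRoot]
            dsimp only
            omega
        · refine Or.inr (Or.inl fun a => ?_)
          rw [Fin.lt_def]
          obtain ha | ha := le_or_gt a.1 m
          · rwa [p.symm_zero_of_le ha, leafRoot, Fin.val_zero]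
          · obtain ⟨b, hb, hba, h⟩ := p.symm_zero_of_lt hm ha
            have := a.2
            rw [h, leafRoot]
            dsimp only
            omega
      by_cases hi1 : i = 1 ∧ D + 1 ≤ c.1 + m
      · obtain ⟨rfl, hcm⟩ := hi1
        refine Or.inl fun a => ?_
        rw [Fin.lt_def, Fin.lt_def, Fin.val_add, Fin.val_ofNat, Nat.add_mod_mod,
          Nat.mod_eq_sub_mod hcm, Nat.mod_eq_of_lt (by omega)]
        obtain ha | ha := lt_or_ge (a.1 + 1) m
        · obtain ⟨b, hb, hba, h⟩ := p.symm_one_of_lt hmD ha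
          rw [h, leafRoot]
          dsimp only
          omega
        · rw [p.root_symm_eq_last hm hi0 fun _ => ha, Fin.val_last]
          omega
      · refine Or.inr (Or.inr fun a => ?_)
        rw [Fin.lt_def]
        by_cases ha : i = 1 → m ≤ a.1 + 1
        · rw [p.root_symm_eq_last hm hi0 ha, Fin.val_last]
          omega
        · push Not at ha
          obtain ⟨rfl, ha⟩ := ha
          obtain ⟨b, hb, hba, h⟩ := p.symm_one_of_lt hmD ha
          rw [h, leafRoot]
          dsimp only
          omega
    constructor <;> refine indicator_mem_of_forall p.toEquiv hsum hN hY fun i => ?_ <;>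
      obtain h | h | h := key i <;> simp only [h, decide_true, decide_false, Bool.not_true,
        Bool.not_false]
    exacts [ih.1, h1, h0, ih.2, h0, h1]

theorem single_self_mem (hm : m ≠ 0) (hmD : m ≤ D) (hcop : Nat.Coprime m (D + 1))
    (hN : ∀ A ∈ N, star A ∈ N)
    (hY : ∀ i, leafMatrix K leafRoot leafWord p.toEquiv i ∈ N) (a : Fin (D + 1)) :
    Matrix.single a a 1 ∈ N := by
  have h := indicator_lt_mem p hm hmD hcop hN hY
  have hle : indicator K (fun b => decide (b ≤ a)) ∈ N := by
    obtain rfl | ha := eq_or_ne a (Fin.last D)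
    · simp [indicator, Fin.le_last]
    · convert (h (a + 1)).1 using 4 with b
      rw [Fin.le_def, Fin.lt_def, Fin.val_add_one_of_lt (Fin.lt_last_iff_ne_last.2 ha)]
      exact Nat.lt_succ_iff.symm
  convert mul_mem hle (h a).2 using 1
  rw [indicator, indicator, Matrix.diagonal_mul_diagonal, ← Matrix.diagonal_single]
  congr 1
  ext b
  rw [Pi.single_apply]
  obtain hb | rfl | hb := lt_trichotomy b a
  · simp [hb, hb.ne]
  · simp
  · simp [hb.not_ge, hb.ne']

theorem leaf_mem (hself : ∀ a, Matrix.single a a 1 ∈ N)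
    (hY : ∀ i, leafMatrix K leafRoot leafWord p.toEquiv i ∈ N) (l : Leaf m D) :
    Matrix.single (leafRoot l) (p.toEquiv l).2 (yW K (m + 1) (leafWord l)) ∈ N := by
  rw [← leafMatrix_mul_single p.toEquiv]
  exact mul_mem (hY _) (hself _)

theorem star_single_mem (hN : ∀ A ∈ N, star A ∈ N) {a b : Fin (D + 1)} {s : Leavitt K (m + 1)}
    (h : Matrix.single a b s ∈ N) : Matrix.single b a (star s) ∈ N := by
  have := hN _ h
  rwa [Matrix.star_eq_conjTranspose, Matrix.conjTranspose_single] at this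

theorem single_mul_mem {a b c : Fin (D + 1)} {s t : Leavitt K (m + 1)}
    (h : Matrix.single a b s ∈ N) (h' : Matrix.single b c t ∈ N) :
    Matrix.single a c (s * t) ∈ N := by
  rw [← Matrix.single_mul_single_same s a b c t]
  exact mul_mem h h'

theorem single_mem_of_label_eq (hcop : Nat.Coprime m (D + 1)) (hN : ∀ A ∈ N, star A ∈ N)
    (hself : ∀ a, Matrix.single a a 1 ∈ N)
    (hY : ∀ i, leafMatrix K leafRoot leafWord p.toEquiv i ∈ N) {a b : Fin (D + 1)}
    (hab : p.label a = p.label b) : Matrix.single a b 1 ∈ N := by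
  have key : ∀ a, Matrix.single a (if p.label a then 0 else Fin.last D) 1 ∈ N := by
    intro a
    induction a using shift_induction hcop with
    | zero => simpa [p.label_zero] using hself 0
    | step a ha ih =>
      by_cases hal : a = Fin.last D
      · subst hal
        simpa [p.label_last] using hself (Fin.last D)
      · rw [p.label_add a ha hal] at ih
        have h := leaf_mem p hself hY (Sum.inl ⟨a, ha, hal⟩)
        rw [p.mid, leafWord, leafRoot, yW_nil] at h
        simpa only [mul_one] using single_mul_mem h ih
  have hb := star_single_mem hN (key b)
  rw [← hab, star_one] at hb
  simpa only [mul_one] using single_mul_mem (key a) hb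

theorem single_zero_last_mem (hcop : Nat.Coprime m (D + 1)) (hN : ∀ A ∈ N, star A ∈ N)
    (hself : ∀ a, Matrix.single a a 1 ∈ N)
    (hY : ∀ i, leafMatrix K leafRoot leafWord p.toEquiv i ∈ N) {k : ℕ} (hk : k ≤ D) :
    Matrix.single 0 (Fin.last D) (xW K (m + 1) (List.replicate k 0)) ∈ N := by
  induction hk using Nat.decreasingInduction with
  | self =>
    have h₁ := star_single_mem hN (leaf_mem p hself hY (Sum.inr (Sum.inr none)))
    have h₂ := single_mem_of_label_eq p hcop hN hself hY
      (p.label_zero.trans p.label_none.symm)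
    have h₃ := single_mul_mem h₂ h₁
    rw [one_mul, star_yW] at h₃
    exact h₃
  | of_succ k hk ih =>
    have hleaf : ∀ j : Fin (m + 1),
        Matrix.single 0 (Fin.ofNat (D + 1) j) (ly K (m + 1) j) ∈ N := fun j => by
      have h := leaf_mem p hself hY (Sum.inr (Sum.inl j))
      rwa [p.zero, leafRoot, leafWord, yW_cons, yW_nil, mul_one] at h
    have hx : xW K (m + 1) (List.replicate k 0) =
        ∑ j, ly K (m + 1) j * xW K (m + 1) (List.replicate k 0 ++ [j]) := by
      simp only [xW_append, xW_cons, xW_nil, one_mul, ← mul_assoc]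
      rw [← Finset.sum_mul, sum_ly_mul_lx, one_mul]
    rw [hx, ← Matrix.singleAddMonoidHom_apply, map_sum]
    refine sum_mem fun j _ => ?_
    rw [Matrix.singleAddMonoidHom_apply]
    induction j using Fin.cases with
    | zero =>
      rw [← List.replicate_succ']
      exact single_mul_mem (hleaf 0) ih
    | succ j =>
      have h₁ := star_single_mem hN
        (leaf_mem p hself hY (Sum.inr (Sum.inr (some (⟨k, hk⟩, j)))))
      have h₂ := single_mem_of_label_eq p hcop hN hself hY (p.label_some ⟨k, hk⟩ j).symm
      have h₃ := single_mul_mem (hleaf j.succ) h₂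
      rw [mul_one] at h₃
      have h₄ := single_mul_mem h₃ h₁
      rw [star_yW] at h₄
      exact h₄

/-- The images of the generators generate all matrices with positive entries. -/
theorem mem_of_forall_positive (hm : m ≠ 0) (hmD : m ≤ D) (hcop : Nat.Coprime m (D + 1))
    (hN : ∀ A ∈ N, star A ∈ N)
    (hY : ∀ i, leafMatrix K leafRoot leafWord p.toEquiv i ∈ N)
    {B : Matrix (Fin (D + 1)) (Fin (D + 1)) (Leavitt K (m + 1))}
    (hB : ∀ i j, B i j ∈ positive K (m + 1)) : B ∈ N := by
  have hself := single_self_mem p hm hmD hcop hN hY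
  have h0l : Matrix.single 0 (Fin.last D) 1 ∈ N :=
    single_zero_last_mem p hcop hN hself hY (Nat.zero_le D)
  have h0 : ∀ a, Matrix.single 0 a 1 ∈ N := fun a => by
    cases ha : p.label a with
    | true => exact single_mem_of_label_eq p hcop hN hself hY (p.label_zero.trans ha.symm)
    | false =>
      simpa only [mul_one] using single_mul_mem h0l
        (single_mem_of_label_eq p hcop hN hself hY (p.label_last.trans ha.symm))
  have h0' : ∀ a, Matrix.single a 0 1 ∈ N := fun a => by
    simpa only [star_one] using star_single_mem hN (h0 a)
  have hy : ∀ j, Matrix.single 0 0 (ly K (m + 1) j) ∈ N := fun j => by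
    have h := leaf_mem p hself hY (Sum.inr (Sum.inl j))
    rw [p.zero, leafRoot, leafWord, yW_cons, yW_nil] at h
    simpa only [mul_one] using single_mul_mem h (h0' _)
  have hpos : ∀ s ∈ positive K (m + 1), Matrix.single 0 0 s ∈ N := by
    intro s hs
    induction hs using positive_induction with
    | hx i => simpa only [star_ly] using star_single_mem hN (hy i)
    | hy i => exact hy i
    | zero => simp
    | one => exact hself 0
    | add a b _ _ ha hb => rw [Matrix.single_add]; exact add_mem ha hb
    | mul a b _ _ ha hb => exact single_mul_mem ha hb
  rw [Matrix.matrix_eq_sum_single B]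
  refine sum_mem fun i _ => sum_mem fun j _ => ?_
  simpa only [mul_one, one_mul] using
    single_mul_mem (single_mul_mem (h0' i) (hpos _ (hB i j))) (h0 j)

end Generation

end Placement

section Existence

theorem exists_equiv_extend {Λ S : Type} [Fintype Λ] [Fintype S] (lab : Λ → Bool)
    (lab' : S → Bool) (hcard : Fintype.card Λ = Fintype.card S)
    (hsum : ∑ l, (lab l).toNat = ∑ s, (lab' s).toNat) (p : Λ → Prop)
    (f : Λ → S) (hf : ∀ l, p l → lab' (f l) = lab l) (hinj : Set.InjOn f {l | p l}) :
    ∃ e : Λ ≃ S, (∀ l, p l → e l = f l) ∧ ∀ l, lab' (e l) = lab l := by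
  classical
  have hc : ∀ c, Fintype.card {l // lab l = c} =
      (Finset.univ.filter fun s => lab' s = c).card := by
    simp only [show ∀ b : Bool, b.toNat = if b then 1 else 0 by decide] at hsum
    rw [← Finset.card_filter, ← Finset.card_filter] at hsum
    have h₁ := Finset.card_filter_add_card_filter_not (s := (Finset.univ : Finset Λ))
      (fun l => lab l = true)
    have h₂ := Finset.card_filter_add_card_filter_not (s := (Finset.univ : Finset S))
      (fun s => lab' s = true)
    rw [Finset.card_univ] at h₁ h₂
    rintro (_ | _)
    · rw [Fintype.card_subtype]
      simp only [Bool.not_eq_true] at h₁ h₂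
      omega
    · rw [Fintype.card_subtype, hsum]
  have hext : ∀ c, ∃ g : {l // lab l = c} ≃ {s // lab' s = c},
      ∀ l : {l // lab l = c}, p l → (g l : S) = f l := by
    intro c
    obtain ⟨g, hg⟩ := Finset.exists_equiv_extend_of_card_eq (hc c)
      (s := Finset.univ.filter fun l : {l // lab l = c} => p l) (f := fun l => f l)
      (by
        intro x hx
        obtain ⟨⟨l, rfl⟩, hl, rfl⟩ := Finset.mem_image.1 hx
        simpa using hf l (Finset.mem_filter.1 hl).2)
      (fun a ha b hb h => Subtype.ext
        (hinj (Finset.mem_filter.1 ha).2 (Finset.mem_filter.1 hb).2 h))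
    refine ⟨g.trans (Equiv.subtypeEquivRight fun s => by simp), fun l hl => ?_⟩
    exact hg l (Finset.mem_filter.2 ⟨Finset.mem_univ l, hl⟩)
  choose g hg using hext
  refine ⟨(Equiv.sigmaFiberEquiv lab).symm.trans ((Equiv.sigmaCongrRight g).trans
    (Equiv.sigmaFiberEquiv lab')), fun l hl => hg _ ⟨l, rfl⟩ hl, fun l => (g _ ⟨l, rfl⟩).2⟩

variable {m D α : ℕ}

/-- The colour of `a`: whether adding `α` to `a * α` produces a carry modulo `D + 1`. -/
def carry (D α a : ℕ) : Bool :=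
  decide (1 ≤ (a + 1) * α % (D + 1) ∧ (a + 1) * α % (D + 1) ≤ α)

theorem sum_range_carry (hα : 0 < α) (hαD : α < D + 1) (k : ℕ) :
    ∑ j ∈ Finset.range k, (carry D α (j + 1)).toNat =
      (k * α + (α - 1)) / (D + 1) := by
  induction k with
  | zero => simpa using (Nat.div_eq_of_lt (by omega)).symm
  | succ k ih =>
    rw [Finset.sum_range_succ, ih, show ∀ b : Bool, b.toNat = if b then 1 else 0 by decide]
    simp only [carry, decide_eq_true_eq]
    obtain ⟨w, hw⟩ : ∃ w, w = (k + 2) * α := ⟨_, rfl⟩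
    have h1 : k * α + (α - 1) = w - 1 - α := by
      have : (k + 2) * α = k * α + α + α := by ring
      omega
    have h2 : (k + 1) * α + (α - 1) = w - 1 := by
      have : (k + 2) * α = (k + 1) * α + α := by ring
      omega
    have h3 : 2 * α ≤ w := by rw [hw]; exact Nat.mul_le_mul_right α (by omega)
    rw [h1, h2, ← hw]
    have h4 := Nat.div_add_mod w (D + 1)
    have h5 := Nat.mod_lt w (Nat.succ_pos D)
    generalize w / (D + 1) = q at h4
    generalize w % (D + 1) = ρ at h4 h5 ⊢
    have hdiv : ∀ x t r, x = (D + 1) * t + r → r < D + 1 → x / (D + 1) = t := by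
      rintro x t r rfl hr
      rw [Nat.mul_add_div (Nat.succ_pos D), Nat.div_eq_of_lt hr, add_zero]
    cases q with
    | zero =>
      rw [hdiv (w - 1) 0 (w - 1) (by omega) (by omega),
        hdiv (w - 1 - α) 0 (w - 1 - α) (by omega) (by omega)]
      rw [if_neg (by omega)]
    | succ q =>
      have hq : (D + 1) * (q + 1) = (D + 1) * q + (D + 1) := Nat.mul_succ _ _
      rw [hq] at h4
      by_cases hρ : ρ = 0
      · rw [hdiv (w - 1) q D (by omega) (by omega),
          hdiv (w - 1 - α) q (D - α) (by omega) (by omega), if_neg (by omega), add_zero]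
      by_cases hρα : ρ ≤ α
      · rw [hdiv (w - 1) (q + 1) (ρ - 1) (by omega) (by omega),
          hdiv (w - 1 - α) q (D + ρ - α) (by omega) (by omega), if_pos (by omega)]
      · rw [hdiv (w - 1) (q + 1) (ρ - 1) (by omega) (by omega),
          hdiv (w - 1 - α) (q + 1) (ρ - 1 - α) (by omega) (by omega), if_neg (by omega), add_zero]

theorem carry_add (hα : α < D + 1) (hαm : m * α % (D + 1) = 1) {a : Fin (D + 1)} (ha : a ≠ 0)
    (hal : a ≠ Fin.last D) : carry D α (a + Fin.ofNat (D + 1) m : Fin (D + 1)) = carry D α a := by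
  have hcop : Nat.Coprime (D + 1) α := by
    refine (Nat.coprime_of_mul_modEq_one m (n := D + 1) ?_).symm
    rw [mul_comm, Nat.ModEq, hαm, Nat.mod_eq_of_lt (by have := Fin.pos_iff_ne_zero.2 ha; omega)]
  have hstep : ((a + Fin.ofNat (D + 1) m : Fin (D + 1)) + 1) * α % (D + 1) =
      ((a + 1) * α % (D + 1) + 1) % (D + 1) := by
    rw [Fin.val_add, Fin.val_ofNat, Nat.add_mod_mod, Nat.mod_add_mod, ← Nat.mod_mul_mod,
      Nat.mod_add_mod, Nat.mod_mul_mod, show (a + m + 1) * α = (a + 1) * α + m * α by ring,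
      Nat.add_mod, hαm, Nat.mod_add_mod]
  have hρ0 : (a + 1) * α % (D + 1) ≠ 0 := by
    intro h
    have h' := hcop.dvd_of_dvd_mul_right (Nat.dvd_of_mod_eq_zero h)
    have := Nat.le_of_dvd (Nat.succ_pos _) h'
    exact hal (Fin.ext (by rw [Fin.val_last]; omega))
  have hρα : (a + 1) * α % (D + 1) ≠ α := by
    intro h
    have h₁ : 0 + α ≡ a * α + α [MOD D + 1] := by
      rw [Nat.ModEq, zero_add, ← Nat.succ_mul, h, Nat.mod_eq_of_lt hα]
    have h₂ := hcop.dvd_of_dvd_mul_right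
      (Nat.modEq_zero_iff_dvd.1 (Nat.ModEq.add_right_cancel' α h₁).symm)
    exact ha (Fin.ext (Nat.eq_zero_of_dvd_of_lt h₂ a.2))
  have hρ := Nat.mod_lt ((a + 1) * α) (Nat.succ_pos D)
  rw [carry, carry, hstep, decide_eq_decide]
  generalize (a + 1) * α % (D + 1) = ρ at hρ0 hρα hρ ⊢
  obtain h | h := eq_or_lt_of_le (Nat.succ_le_of_lt hρ)
  · rw [show ρ + 1 = D + 1 from h, Nat.mod_self]
    omega
  · rw [Nat.mod_eq_of_lt h]
    omega

theorem sum_mid (hD : D ≠ 0) (f : Fin (D + 1) → ℕ) :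
    ∑ b, f b = f 0 + f (Fin.last D) +
      ∑ b : {b : Fin (D + 1) // b ≠ 0 ∧ b ≠ Fin.last D}, f b := by
  have h : ∑ b ∈ Finset.univ \ {0, Fin.last D}, f b =
      ∑ b : {b : Fin (D + 1) // b ≠ 0 ∧ b ≠ Fin.last D}, f b :=
    Finset.sum_subtype _ (by simp) f
  have h₂ := Finset.sum_sdiff (f := f) (Finset.subset_univ {0, Fin.last D})
  rw [Finset.sum_pair (zero_ne_last hD), h] at h₂
  omega

theorem nonempty_placement (hm : m ≠ 0) (hmD : m ≤ D) (hcop : Nat.Coprime m (D + 1)) :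
    Nonempty (Placement m D) := by
  obtain ⟨α, hαD, hαm⟩ := Nat.exists_mul_mod_eq_one_of_coprime hcop (by omega)
  have hα : 0 < α := Nat.pos_of_ne_zero (by rintro rfl; simp at hαm)
  have hD : D ≠ 0 := by omega
  have h0 : carry D α 0 = true := by
    simp [carry, Nat.mod_eq_of_lt hαD]; omega
  have hlast : carry D α D = false := by simp [carry]
  let lab : Leaf m D → Bool := Sum.elim (fun b => carry D α b)
    (Sum.elim (fun j => carry D α (Fin.ofNat (D + 1) j))
      fun o => o.elim true fun x => carry D α (Fin.ofNat (D + 1) (x.2 + 1)))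
  let f : Leaf m D → Fin (m + 1) × Fin (D + 1) := Sum.elim
    (fun b => (if b.1 + m < D + 1 then 0 else 1, b + Fin.ofNat (D + 1) m))
    (Sum.elim (fun j => (0, Fin.ofNat (D + 1) j)) fun _ => (0, 0))
  have hall : ∑ b : Fin (D + 1), (carry D α b).toNat = α := by
    rw [Fin.sum_univ_succ]
    simp only [Fin.val_succ, Fin.val_zero]
    rw [Fin.sum_univ_eq_sum_range (fun j => (carry D α (j + 1)).toNat), sum_range_carry hα hαD, h0]
    have : D * α + (α - 1) = (D + 1) * (α - 1) + D := by
      obtain ⟨β, rfl⟩ := Nat.exists_eq_add_of_lt hα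
      simp
      ring
    rw [this, Nat.mul_add_div (Nat.succ_pos D), Nat.div_eq_of_lt (Nat.lt_succ_self D)]
    simp only [Bool.toNat_true]
    omega
  have hmid : ∑ b : {b : Fin (D + 1) // b ≠ 0 ∧ b ≠ Fin.last D}, (carry D α b.1).toNat + 1 = α := by
    have h := sum_mid hD fun b => (carry D α b).toNat
    rw [hall, Fin.val_zero, Fin.val_last, h0, hlast, Bool.toNat_true, Bool.toNat_false] at h
    omega
  have hcarry : m * α = (D + 1) * ∑ j : Fin m, (carry D α (j + 1)).toNat + 1 := by
    have h := Nat.div_add_mod (m * α) (D + 1)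
    rw [hαm] at h
    rw [Fin.sum_univ_eq_sum_range (fun j => (carry D α (j + 1)).toNat), sum_range_carry hα hαD]
    generalize m * α / (D + 1) = q at h
    rw [← h, add_assoc, Nat.mul_add_div (Nat.succ_pos D), Nat.div_eq_of_lt (by omega), add_zero]
  obtain ⟨e, he, hlab⟩ : ∃ e : Leaf m D ≃ Fin (m + 1) × Fin (D + 1),
      (∀ l, (∀ o, l ≠ Sum.inr (Sum.inr o)) → e l = f l) ∧ ∀ l, carry D α (e l).2 = lab l := by
    refine exists_equiv_extend lab (fun s => carry D α s.2) ?_ ?_ _ f ?_ ?_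
    · have h := sum_mid hD fun _ => 1
      rw [← Finset.card_eq_sum_ones, ← Finset.card_eq_sum_ones, Finset.card_univ,
        Finset.card_univ, Fintype.card_fin] at h
      rw [Fintype.card_sum, Fintype.card_sum, Fintype.card_option, Fintype.card_prod,
        Fintype.card_prod, Fintype.card_fin, Fintype.card_fin, Fintype.card_fin, Fintype.card_fin]
      ring_nf
      ring_nf at h
      omega
    · rw [Fintype.sum_sum_type, Fintype.sum_sum_type, Fintype.sum_option, Fintype.sum_prod_type,
        Fintype.sum_prod_type]
      simp only [lab, Sum.elim_inl, Sum.elim_inr, Option.elim, Fin.val_ofNat, Bool.toNat_true]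
      rw [hall, Fin.sum_univ_succ]
      have hmod₁ : ∀ j : Fin m, (j + 1 : ℕ) % (D + 1) = j + 1 := fun j =>
        Nat.mod_eq_of_lt (by omega)
      simp only [Fin.val_succ, hmod₁, Fin.val_zero, Nat.zero_mod, h0, Bool.toNat_true,
        Finset.sum_const, Finset.card_univ, Fintype.card_fin, smul_eq_mul]
      rw [add_mul, hcarry, add_mul]
      omega
    · rintro (⟨b, hb⟩ | j | o) hl
      · exact carry_add hαD hαm hb.1 hb.2
      · rfl
      · exact absurd rfl (hl o)
    · have hne : ∀ b hb (j : Fin (m + 1)), f (Sum.inl ⟨b, hb⟩) ≠ f (Sum.inr (Sum.inl j)) := by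
        intro b hb j h
        have hb0 := Fin.pos_iff_ne_zero.2 hb.1
        simp only [f, Sum.elim_inl, Sum.elim_inr, Prod.mk.injEq] at h
        split_ifs at h with hlt
        · have h' := congrArg Fin.val h.2
          rw [Fin.val_add, Fin.val_ofNat, Fin.val_ofNat, Nat.add_mod_mod, Nat.mod_eq_of_lt hlt,
            Nat.mod_eq_of_lt (by omega)] at h'
          omega
        · exact hm (by simpa using h.1)
      rintro (⟨b, hb⟩ | j | o) hl (⟨b', hb'⟩ | j' | o') hl' h
      · simp only [f, Sum.elim_inl, Prod.mk.injEq] at h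
        simpa using h.2
      · exact absurd h (hne b hb j')
      · exact absurd rfl (hl' o')
      · exact absurd h.symm (hne b' hb' j)
      · simp only [f, Sum.elim_inl, Sum.elim_inr, Prod.mk.injEq] at h
        have h' := congrArg Fin.val h.2
        rw [Fin.val_ofNat, Fin.val_ofNat, Nat.mod_eq_of_lt (by omega),
          Nat.mod_eq_of_lt (by omega)] at h'
        rw [Fin.ext h']
      · exact absurd rfl (hl' o')
      all_goals exact absurd rfl (hl o)
  exact ⟨{
    toEquiv := e
    label := fun a => carry D α a
    mid := fun b hb => he _ (by simp)
    zero := fun j => he _ (by simp)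
    label_zero := h0
    label_last := hlast
    label_add := fun a => carry_add hαD hαm
    label_none := hlab _
    label_some := fun k j => hlab _ }⟩

end Existence

section Expansion

variable {K : Type} [Field K] {m D : ℕ} {ι : Type} [Fintype ι] [DecidableEq ι]

theorem nonempty_mulEquiv_prod (hm : m ≠ 0) (hmD : m ≤ D) (hcop : Nat.Coprime m (D + 1)) :
    Nonempty (positiveUnitary K (m + 1) ι ≃* positiveUnitary K (m + 1) (ι × Fin (D + 1))) := by
  have hD : D ≠ 0 := by omega
  obtain ⟨p⟩ := nonempty_placement hm hmD hcop
  obtain ⟨φ, hy, hx⟩ := exists_algHom_leafMatrix (K := K) p.toEquiv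
    (xW_leafWord_mul_yW_leafWord K hD) (sum_leafWord K hD)
  have hinj : Function.Injective φ := algHom_injective (by omega) φ fun h => by
    simpa using congrFun (congrFun h 0) 0
  have hφ : ∀ a ∈ positive K (m + 1), φ (star a) = star (φ a) ∧
      ∀ i j, φ a i j ∈ positive K (m + 1) := by
    intro a ha
    induction ha using positive_induction with
    | hx i =>
      refine ⟨by rw [star_lx, hy, hx, star_star], fun a b => ?_⟩
      rw [hx, Matrix.star_apply]
      exact star_mem_positive (leafMatrix_mem_positive leafRoot leafWord p.toEquiv i b a)
    | hy i =>
      refine ⟨by rw [star_ly, hy, hx], fun a b => ?_⟩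
      rw [hy]
      exact leafMatrix_mem_positive leafRoot leafWord p.toEquiv i a b
    | zero => exact ⟨by simp, fun a b => by rw [map_zero]; exact zero_mem _⟩
    | one =>
      refine ⟨by simp, fun a b => ?_⟩
      rw [map_one, Matrix.one_apply]
      split_ifs
      exacts [one_mem _, zero_mem _]
    | add a b _ _ ha hb =>
      refine ⟨by rw [star_add, map_add, map_add, star_add, ha.1, hb.1], fun i j => ?_⟩
      rw [map_add]
      exact add_mem (ha.2 i j) (hb.2 i j)
    | mul a b _ _ ha hb =>
      refine ⟨by rw [star_mul, map_mul, map_mul, star_mul, ha.1, hb.1], fun i j => ?_⟩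
      rw [map_mul]
      exact mul_apply_mem_positive ha.2 hb.2 i j
  have hsurj : ∀ B : Matrix (Fin (D + 1)) (Fin (D + 1)) (Leavitt K (m + 1)),
      (∀ i j, B i j ∈ positive K (m + 1)) → ∃ a ∈ positive K (m + 1), φ a = B := by
    intro B hB
    refine mem_of_forall_positive (N := (positive K (m + 1)).map φ.toRingHom) p hm hmD hcop
      ?_ (fun i => ⟨_, ly_mem_positive i, hy i⟩) hB
    rintro _ ⟨a, ha, rfl⟩
    exact ⟨star a, star_mem_positive ha, (hφ a ha).1⟩
  let F : Matrix ι ι (Leavitt K (m + 1)) →+*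
      Matrix (ι × Fin (D + 1)) (ι × Fin (D + 1)) (Leavitt K (m + 1)) :=
    (Matrix.compRingEquiv ι (Fin (D + 1)) (Leavitt K (m + 1))).toRingHom.comp
      φ.toRingHom.mapMatrix
  have hF : ∀ A i j, F A i j = φ (A i.1 j.1) i.2 j.2 := fun A i j => rfl
  refine nonempty_mulEquiv_of_monoidHom (F : _ →* _) (fun A B h => ?_) (fun A hA => ?_)
    (fun A hA i j => (hφ _ (hA i.1 j.1)).2 i.2 j.2) (fun B hB => ?_)
  · ext i j
    refine hinj (Matrix.ext fun a b => ?_)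
    exact congrFun (congrFun h (i, a)) (j, b)
  · ext i j
    change φ (star (A j.1 i.1)) i.2 j.2 = star (φ (A j.1 i.1) j.2 i.2)
    rw [(hφ _ (hA j.1 i.1)).1, Matrix.star_apply]
  · choose A hA hAB using fun i j => hsurj (Matrix.of fun a b => B (i, a) (j, b))
      fun a b => hB (i, a) (j, b)
    refine ⟨Matrix.of A, hA, ?_⟩
    ext i j
    exact congrFun (congrFun (hAB i.1 j.1) i.2) j.2

theorem nonempty_mulEquiv_mul (hm : m ≠ 0) {r d : ℕ} (hd : m < d) (hcop : Nat.Coprime m d) :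
    Nonempty (positiveUnitary K (m + 1) (Fin r) ≃* positiveUnitary K (m + 1) (Fin (r * d))) := by
  obtain ⟨D, rfl⟩ := Nat.exists_eq_add_of_lt (Nat.zero_lt_of_lt hd)
  rw [zero_add] at *
  obtain ⟨e⟩ := nonempty_mulEquiv_prod (K := K) (ι := Fin r) hm (Nat.le_of_lt_succ hd) hcop
  obtain ⟨e'⟩ := nonempty_mulEquiv_of_equiv (K := K) (n := m + 1)
    (finProdFinEquiv (m := r) (n := D + 1))
  exact ⟨e.trans e'⟩

theorem nonempty_mulEquiv_add {r : ℕ} (hr : r ≠ 0) :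
    Nonempty (positiveUnitary K (m + 1) (Fin r) ≃* positiveUnitary K (m + 1) (Fin (r + m))) := by
  obtain ⟨r, rfl⟩ := Nat.exists_eq_succ_of_ne_zero hr
  obtain ⟨e⟩ := nonempty_mulEquiv_split (K := K) (n := m + 1) (ι := Fin r)
  obtain ⟨e₁⟩ := nonempty_mulEquiv_of_equiv (K := K) (n := m + 1)
    (Fintype.equivFinOfCardEq (α := Fin r ⊕ Unit) (n := r.succ) (by simp))
  obtain ⟨e₂⟩ := nonempty_mulEquiv_of_equiv (K := K) (n := m + 1)
    (Fintype.equivFinOfCardEq (α := Fin r ⊕ Fin (m + 1)) (n := r.succ + m) (by simp; omega))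
  exact ⟨e₁.symm.trans (e.trans e₂)⟩

theorem nonempty_mulEquiv_of_modEq {r s : ℕ} (hr : r ≠ 0) (hs : s ≠ 0) (h : r ≡ s [MOD m]) :
    Nonempty (positiveUnitary K (m + 1) (Fin r) ≃* positiveUnitary K (m + 1) (Fin s)) := by
  wlog hrs : r ≤ s generalizing r s
  · obtain ⟨e⟩ := this hs hr h.symm (le_of_not_ge hrs)
    exact ⟨e.symm⟩
  obtain ⟨k, hk⟩ := (Nat.modEq_iff_dvd' hrs).1 h
  obtain rfl : s = r + m * k := by omega
  clear hs h hrs hk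
  induction k with
  | zero => exact ⟨MulEquiv.refl _⟩
  | succ k ih =>
    obtain ⟨e⟩ := ih
    obtain ⟨e₁⟩ := nonempty_mulEquiv_add (K := K) (m := m) (r := r + m * k) (by omega)
    rw [Nat.mul_succ, ← add_assoc]
    exact ⟨e.trans e₁⟩

/-- Integers with the same greatest common divisor with `m` agree modulo `m` up to a unit. -/
theorem exists_coprime_mul_modEq (hm : m ≠ 0) {r s : ℕ} (h : Nat.gcd m r = Nat.gcd m s) :
    ∃ d, m < d ∧ Nat.Coprime m d ∧ r * d ≡ s [MOD m] := by
  have : NeZero m := ⟨hm⟩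
  have hg : 0 < Nat.gcd m r := Nat.gcd_pos_of_pos_left _ (Nat.pos_of_ne_zero hm)
  have hmg := Nat.div_mul_cancel (Nat.gcd_dvd_left m r)
  have hrg := Nat.div_mul_cancel (Nat.gcd_dvd_right m r)
  have hsg := Nat.div_mul_cancel (Nat.gcd_dvd_right m s)
  have hr := Nat.coprime_div_gcd_div_gcd hg
  have hs := Nat.coprime_div_gcd_div_gcd (h ▸ hg)
  rw [← h] at hs hsg
  generalize Nat.gcd m r = g at *
  generalize m / g = m' at *
  generalize r / g = r' at *
  generalize s / g = s' at *
  obtain ⟨u, hu⟩ := ZMod.unitsMap_surjective (Dvd.intro g hmg)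
    (ZMod.unitOfCoprime s' hs.symm * (ZMod.unitOfCoprime r' hr.symm)⁻¹)
  refine ⟨(u : ZMod m).val + m + m, ?_, ?_, ?_⟩
  · omega
  · simpa [Nat.coprime_comm] using ZMod.val_coe_unit_coprime u
  · have h₁ : r' * (u : ZMod m).val ≡ s' [MOD m'] := by
      rw [← ZMod.natCast_eq_natCast_iff]
      have h₂ : ((u : ZMod m).val : ZMod m') = s' *
          ((ZMod.unitOfCoprime r' hr.symm)⁻¹ : (ZMod m')ˣ) := by
        have := congrArg Units.val hu
        rw [ZMod.unitsMap_val] at this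
        rw [ZMod.natCast_val, this]
        simp
      rw [Nat.cast_mul, h₂, mul_left_comm]
      have h₃ := (ZMod.unitOfCoprime r' hr.symm).mul_inv
      rw [ZMod.coe_unitOfCoprime] at h₃
      rw [h₃, mul_one]
    have h₄ := h₁.mul_right' g
    rw [hmg, hsg, mul_right_comm, hrg] at h₄
    rw [mul_add, mul_add, Nat.ModEq, Nat.add_mul_mod_self_right, Nat.add_mul_mod_self_right]
    exact h₄

end Expansion

theorem coe_positiveUnitary (K : Type) [Field K] (n r : ℕ) :
    (positiveUnitary K n (Fin r) : Set (Matrix (Fin r) (Fin r) (Leavitt K n))) = PsetM K n r := by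
  ext A
  exact and_congr Iff.rfl (forall₂_congr fun i j => isSumYX_iff.symm)

end Leavitt

/-- If `gcd (n-1) r = gcd (n-1) s`, then the groups `P_{n,r}` and `P_{n,s}` (under matrix
multiplication) are isomorphic: there is a multiplicative bijection between them. -/
theorem psetM_iso_of_gcd_eq (K : Type) [Field K] (n r s : ℕ) (hn : 2 ≤ n)
    (hr : 1 ≤ r) (hs : 1 ≤ s)
    (hgcd : Nat.gcd (n - 1) r = Nat.gcd (n - 1) s) :
    ∃ e : ↥(PsetM K n r) ≃ ↥(PsetM K n s),
      ∀ A B : ↥(PsetM K n r), ∃ h : A.val * B.val ∈ PsetM K n r,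
        (e ⟨A.val * B.val, h⟩).val = (e A).val * (e B).val := by
  obtain ⟨m, rfl⟩ := Nat.exists_eq_add_of_le' (show 1 ≤ n by omega)
  rw [Nat.add_sub_cancel] at hgcd
  obtain ⟨d, hd, hcop, hmod⟩ := Leavitt.exists_coprime_mul_modEq (by omega) hgcd
  obtain ⟨e₁⟩ := Leavitt.nonempty_mulEquiv_mul (K := K) (by omega) (r := r) hd hcop
  obtain ⟨e₂⟩ := Leavitt.nonempty_mulEquiv_of_modEq (K := K)
    (mul_ne_zero (by omega) (by omega)) (by omega) hmod
  let e := e₁.trans e₂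
  rw [← Leavitt.coe_positiveUnitary, ← Leavitt.coe_positiveUnitary]
  exact ⟨e.toEquiv, fun A B => ⟨mul_mem A.2 B.2, congrArg Subtype.val (map_mul e A B)⟩⟩
end
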